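/- arXiv:1810.01946 — 3 statements merged into one kernel-verified Lean document; each statement's English description precedes it below -/
import Mathlib

section
/- There is an absolute constant C such that the following holds for every integer l ≥ 2, every grid half-size m ≥ l, and every assignment of real elevations to the grid points: if S is the set of edges of layers ⌈l/2⌉, ⌈l/2⌉+1, …, l (the l/2 outermost layers in a square region of l layers around the viewpoint), then the horizon of S has complexity at most C·l². -/
/-!
STATEMENT 4: There is an absolute constant C such that for every l ≥ 2, every grid
half-size m ≥ l, and every assignment of elevations to the grid points, the horizon
of the set of edges of layers ⌈l/2⌉, …, l (the l/2 outermost layers of a square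
region of l layers around the viewpoint) has complexity at most C·l².
-/

/-- The grid point `p(i,j) = (j, -i, Z i j)` of the terrain with elevations `Z`. -/
def gridPt (Z : ℤ → ℤ → ℝ) (i j : ℤ) : ℝ × ℝ × ℝ :=
  ((j : ℝ), (-(i : ℝ), Z i j))

/-- The azimuth parameter `t ∈ [0, 4)` of a point `r = (x, y, z)` (off the
vertical axis): projected points with equal azimuth parameter lie on a common
vertical line of the view screen.  South of the viewpoint (`y ≤ 0`) it is
`1 - x/(|x|+|y|) ∈ [0,2]`; north of it, `3 + x/(|x|+|y|) ∈ (2,4)`. -/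
noncomputable def azimuth (r : ℝ × ℝ × ℝ) : ℝ :=
  if r.2.1 ≤ 0 then 1 - r.1 / (|r.1| + |r.2.1|) else 3 + r.1 / (|r.1| + |r.2.1|)

/-- The height of the projection `r/(|x|+|y|)` of `r = (x, y, z)` onto the view
screen. -/
noncomputable def scrHeight (r : ℝ × ℝ × ℝ) : ℝ := r.2.2 / (|r.1| + |r.2.1|)

/-- `e` is an edge of layer `l`: it connects two consecutive grid points (indexed
by `(i, j)`) whose L∞-distance from the viewpoint in the horizontal plane is `l`. -/
def IsLayerEdge (l : ℕ) (e : (ℤ × ℤ) × (ℤ × ℤ)) : Prop :=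
  max |e.1.1| |e.1.2| = (l : ℤ) ∧ max |e.2.1| |e.2.2| = (l : ℤ) ∧
  |e.1.1 - e.2.1| + |e.1.2 - e.2.2| = 1

/-- The points of the 3D line segment of the edge `e` (linear interpolation
between the two grid points). -/
noncomputable def edgePts (Z : ℤ → ℤ → ℝ) (e : (ℤ × ℤ) × (ℤ × ℤ)) :
    Set (ℝ × ℝ × ℝ) :=
  segment ℝ (gridPt Z e.1.1 e.1.2) (gridPt Z e.2.1 e.2.2)

/-- The horizon of a set `E` of edges: the upper envelope of the projections of
the edges onto the view screen, i.e. the function assigning to each azimuth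
parameter `t` the maximum height of a projected edge point at azimuth `t`. -/
noncomputable def horizon (Z : ℤ → ℤ → ℝ) (E : Set ((ℤ × ℤ) × (ℤ × ℤ))) (t : ℝ) :
    ℝ :=
  sSup {h : ℝ | ∃ e ∈ E, ∃ r ∈ edgePts Z e, azimuth r = t ∧ scrHeight r = h}

/-- `I` is a piece of the horizon of `E`: a nonempty azimuth interval on which the
horizon coincides with the projection of a single edge of `E`. -/
def HorizonPiece (Z : ℤ → ℤ → ℝ) (E : Set ((ℤ × ℤ) × (ℤ × ℤ))) (I : Set ℝ) :
    Prop :=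
  I.Nonempty ∧ I.OrdConnected ∧
    ∃ e ∈ E, ∀ t ∈ I, ∃ r ∈ edgePts Z e,
      azimuth r = t ∧ scrHeight r = horizon Z E t

/-- `I` is a maximal piece of the horizon of `E`. -/
def MaxHorizonPiece (Z : ℤ → ℤ → ℝ) (E : Set ((ℤ × ℤ) × (ℤ × ℤ))) (I : Set ℝ) :
    Prop :=
  HorizonPiece Z E I ∧ ∀ J : Set ℝ, HorizonPiece Z E J → I ⊆ J → J = I

theorem azimuth_range (r : ℝ × ℝ × ℝ) : 0 ≤ azimuth r ∧ azimuth r < 4 := by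
  obtain ⟨x, y, z⟩ := r
  unfold azimuth
  simp only
  have hx := abs_nonneg x
  have hy := abs_nonneg y
  have h1 : x / (|x| + |y|) ≤ 1 :=
    div_le_one_of_le₀ (by linarith [le_abs_self x]) (by linarith)
  have h2 : -1 ≤ x / (|x| + |y|) := by
    have : -x / (|x| + |y|) ≤ 1 :=
      div_le_one_of_le₀ (by linarith [neg_abs_le x]) (by linarith)
    rw [neg_div] at this; linarith
  split_ifs with h
  · constructor <;> linarith
  · push Not at h
    have h3 : x / (|x| + |y|) < 1 := by
      have : 0 < |y| := abs_pos.2 h.ne'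
      rw [div_lt_one (by linarith)]
      linarith [le_abs_self x]
    constructor <;> linarith

theorem azimuth_lift (x y z τ t : ℝ) (hτ : τ = 1 ∨ τ = -1) (hy : 0 ≤ τ * y)
    (hn : 0 < |x| + |y|) (h0 : 0 < t) (h4 : t < 4) :
    azimuth (x, y, z) = t ↔ 2 + τ + τ * (x / (|x| + |y|)) = t := by
  unfold azimuth
  simp only
  rcases hτ with rfl | rfl
  · by_cases h : y ≤ 0
    · have hy0 : y = 0 := by linarith
      subst hy0
      rw [if_pos h]
      simp only [abs_zero, add_zero] at hn ⊢
      rcases lt_trichotomy x 0 with hx | hx | hx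
      · rw [abs_of_neg hx, div_neg, div_self hx.ne]
        constructor <;> intro h <;> linarith
      · simp [hx] at hn
      · rw [abs_of_pos hx, div_self hx.ne']
        constructor <;> intro h <;> linarith
    · rw [if_neg h]
      constructor <;> intro h <;> linarith
  · rw [if_pos (by linarith)]
    constructor <;> intro h <;> linarith

theorem seg_core (x1 y1 z1 x2 y2 z2 σ τ t h : ℝ) (hσ : σ = 1 ∨ σ = -1)
    (hτ : τ = 1 ∨ τ = -1) (hx1 : 0 ≤ σ * x1) (hx2 : 0 ≤ σ * x2) (hy1 : 0 ≤ τ * y1)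
    (hy2 : 0 ≤ τ * y2) (n1 n2 : ℝ) (hn1 : n1 = σ * x1 + τ * y1) (hn2 : n2 = σ * x2 + τ * y2)
    (p1 : 0 < n1) (p2 : 0 < n2) (h0 : 0 < t) (h4 : t < 4) :
    (∃ r ∈ segment ℝ ((x1, y1, z1) : ℝ × ℝ × ℝ) (x2, y2, z2), azimuth r = t ∧ scrHeight r = h) ↔
    ∃ μ : ℝ, 0 ≤ μ ∧ μ ≤ 1 ∧ t = 2 + τ + τ * ((1 - μ) * (x1 / n1) + μ * (x2 / n2)) ∧
      h = (1 - μ) * (z1 / n1) + μ * (z2 / n2) := by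
  have key : ∀ a b : ℝ, 0 ≤ a → 0 ≤ b → a + b = 1 →
      0 ≤ τ * (a * y1 + b * y2) ∧ |a * x1 + b * x2| + |a * y1 + b * y2| = a * n1 + b * n2 ∧
      0 < a * n1 + b * n2 := by
    intro a b ha hb hab
    have e1 : 0 ≤ τ * (a * y1 + b * y2) := by
      have := mul_nonneg ha hy1
      have := mul_nonneg hb hy2
      nlinarith
    have e2 : 0 ≤ σ * (a * x1 + b * x2) := by
      have := mul_nonneg ha hx1
      have := mul_nonneg hb hx2
      nlinarith
    refine ⟨e1, ?_, ?_⟩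
    · have f1 : |a * x1 + b * x2| = σ * (a * x1 + b * x2) := by
        rcases hσ with rfl | rfl
        · rw [abs_of_nonneg (by linarith)]; ring
        · rw [abs_of_nonpos (by linarith)]; ring
      have f2 : |a * y1 + b * y2| = τ * (a * y1 + b * y2) := by
        rcases hτ with rfl | rfl
        · rw [abs_of_nonneg (by linarith)]; ring
        · rw [abs_of_nonpos (by linarith)]; ring
      rw [f1, f2, hn1, hn2]; ring
    · rcases ha.eq_or_lt with rfl | ha'
      · have : b = 1 := by linarith
        subst this; linarith
      · have := mul_pos ha' p1
        have := mul_nonneg hb p2.le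
        linarith
  constructor
  · rintro ⟨r, ⟨a, b, ha, hb, hab, rfl⟩, hr1, hr2⟩
    obtain ⟨k1, k2, k3⟩ := key a b ha hb hab
    have k4 : a * n1 + b * n2 ≠ 0 := k3.ne'
    simp only [Prod.smul_mk, Prod.mk_add_mk, smul_eq_mul] at hr1 hr2
    rw [azimuth_lift _ _ _ τ t hτ k1 (by rw [k2]; exact k3) h0 h4, k2] at hr1
    unfold scrHeight at hr2
    simp only at hr2
    rw [k2] at hr2
    refine ⟨b * n2 / (a * n1 + b * n2), by positivity, ?_, ?_, ?_⟩
    · rw [div_le_one k3]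
      have := mul_nonneg ha p1.le
      linarith
    · rw [← hr1]
      have : 1 - b * n2 / (a * n1 + b * n2) = a * n1 / (a * n1 + b * n2) := by
        field_simp; ring
      rw [this]
      field_simp
    · rw [← hr2]
      have : 1 - b * n2 / (a * n1 + b * n2) = a * n1 / (a * n1 + b * n2) := by
        field_simp; ring
      rw [this]
      field_simp
  · rintro ⟨μ, m0, m1, ht, hh⟩
    have hD : 0 < (1 - μ) * n2 + μ * n1 := by
      rcases m0.eq_or_lt with rfl | hm
      · linarith
      · have := mul_pos hm p1
        have := mul_nonneg (sub_nonneg.2 m1) p2.le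
        linarith
    set D := (1 - μ) * n2 + μ * n1 with hDdef
    have hD' : D ≠ 0 := hD.ne'
    have ha : 0 ≤ (1 - μ) * n2 / D := div_nonneg (mul_nonneg (sub_nonneg.2 m1) p2.le) hD.le
    have hb : 0 ≤ μ * n1 / D := by positivity
    have hab : (1 - μ) * n2 / D + μ * n1 / D = 1 := by rw [← add_div, div_self hD']
    obtain ⟨k1, k2, k3⟩ := key _ _ ha hb hab
    have k5 : (1 - μ) * n2 / D * n1 + μ * n1 / D * n2 = n1 * n2 / D := by
      field_simp; ring
    refine ⟨_, ⟨_, _, ha, hb, hab, rfl⟩, ?_, ?_⟩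
    · simp only [Prod.smul_mk, Prod.mk_add_mk, smul_eq_mul]
      rw [azimuth_lift _ _ _ τ t hτ k1 (by rw [k2]; exact k3) h0 h4, k2, k5, ht]
      congr 2
      field_simp
    · simp only [Prod.smul_mk, Prod.mk_add_mk, smul_eq_mul]
      unfold scrHeight
      simp only
      rw [k2, k5, hh]
      field_simp

theorem edge_interface (Z : ℤ → ℤ → ℝ) (k : ℕ) (hk : 1 ≤ k) (e : (ℤ × ℤ) × (ℤ × ℤ))
    (he : IsLayerEdge k e) : ∃ a b α β : ℝ, a + 1 / (4 * k) ≤ b ∧ b ≤ a + 1 / k ∧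
      ∀ t h : ℝ, 0 < t → t < 4 →
        ((∃ r ∈ edgePts Z e, azimuth r = t ∧ scrHeight r = h) ↔
          (a ≤ t ∧ t ≤ b) ∧ h = α * t + β) := by
  obtain ⟨⟨i1, j1⟩, ⟨i2, j2⟩⟩ := e
  obtain ⟨e1, e2, e3⟩ := he
  simp only at e1 e2 e3
  have hdet : |j1 * i2 - j2 * i1| = k := by
    have : (j1 = j2 ∧ |j1| = k ∧ (i2 = i1 + 1 ∨ i2 = i1 - 1)) ∨
        (i1 = i2 ∧ |i1| = k ∧ (j2 = j1 + 1 ∨ j2 = j1 - 1)) := by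
      grind
    rcases this with ⟨rfl, h, rfl | rfl⟩ | ⟨rfl, h, rfl | rfl⟩
    · rw [← h]; congr 1; ring
    · rw [← h, ← abs_neg]; congr 1; ring
    · rw [← h, ← abs_neg]; congr 1; ring
    · rw [← h]; congr 1; ring
  obtain ⟨s, hs, sj1, sj2⟩ : ∃ s : ℤ, (s = 1 ∨ s = -1) ∧ 0 ≤ s * j1 ∧ 0 ≤ s * j2 := by
    have : (0 ≤ j1 ∧ 0 ≤ j2) ∨ (j1 ≤ 0 ∧ j2 ≤ 0) := by grind
    rcases this with h | h
    · exact ⟨1, by simp, by omega, by omega⟩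
    · exact ⟨-1, by simp, by omega, by omega⟩
  obtain ⟨u, hu, ui1, ui2⟩ : ∃ s : ℤ, (s = 1 ∨ s = -1) ∧ 0 ≤ s * -i1 ∧ 0 ≤ s * -i2 := by
    have : (0 ≤ i1 ∧ 0 ≤ i2) ∨ (i1 ≤ 0 ∧ i2 ≤ 0) := by grind
    rcases this with h | h
    · exact ⟨-1, by simp, by omega, by omega⟩
    · exact ⟨1, by simp, by omega, by omega⟩
  have b1 : (k : ℤ) ≤ s * j1 + u * -i1 ∧ s * j1 + u * -i1 ≤ 2 * k := by
    rcases hs with rfl | rfl <;> rcases hu with rfl | rfl <;> grind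
  have b2 : (k : ℤ) ≤ s * j2 + u * -i2 ∧ s * j2 + u * -i2 ≤ 2 * k := by
    rcases hs with rfl | rfl <;> rcases hu with rfl | rfl <;> grind
  have hkR : (1 : ℝ) ≤ k := by exact_mod_cast hk
  obtain ⟨n1, hn1⟩ : ∃ n1 : ℝ, n1 = (s : ℝ) * j1 + u * -(i1 : ℝ) := ⟨_, rfl⟩
  obtain ⟨n2, hn2⟩ : ∃ n2 : ℝ, n2 = (s : ℝ) * j2 + u * -(i2 : ℝ) := ⟨_, rfl⟩
  have c1 : (k : ℝ) ≤ n1 := by rw [hn1]; exact_mod_cast b1.1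
  have c1' : n1 ≤ 2 * k := by rw [hn1]; exact_mod_cast b1.2
  have c2 : (k : ℝ) ≤ n2 := by rw [hn2]; exact_mod_cast b2.1
  have c2' : n2 ≤ 2 * k := by rw [hn2]; exact_mod_cast b2.2
  have p1 : 0 < n1 := by linarith
  have p2 : 0 < n2 := by linarith
  have huR : (u : ℝ) = 1 ∨ (u : ℝ) = -1 := by rcases hu with rfl | rfl <;> simp
  have hsR : (s : ℝ) = 1 ∨ (s : ℝ) = -1 := by rcases hs with rfl | rfl <;> simp
  have hdR : |(j1 : ℝ) * i2 - j2 * i1| = k := by exact_mod_cast hdet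
  obtain ⟨A1, hA1⟩ : ∃ A1 : ℝ, A1 = 2 + u + u * (j1 / n1) := ⟨_, rfl⟩
  obtain ⟨A2, hA2⟩ : ∃ A2 : ℝ, A2 = 2 + u + u * (j2 / n2) := ⟨_, rfl⟩
  have hdiff : |A2 - A1| = k / (n1 * n2) := by
    have hu2 : (u : ℝ) * u = 1 := by rcases huR with h | h <;> rw [h] <;> norm_num
    have : A2 - A1 = (j1 * i2 - j2 * i1) / (n1 * n2) := by
      rw [hA1, hA2]
      field_simp
      rw [hn1, hn2]
      linear_combination (↑i2 * ↑j1 - ↑i1 * ↑j2 : ℝ) * hu2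
    rw [this, abs_div, hdR, abs_of_pos (by positivity)]
  have kp : (0 : ℝ) < k := by linarith
  have w1 : 1 / (4 * (k : ℝ)) ≤ |A2 - A1| := by
    rw [hdiff, div_le_div_iff₀ (by positivity) (by positivity)]
    nlinarith [mul_le_mul c1' c2' p2.le (by positivity)]
  have w2 : |A2 - A1| ≤ 1 / (k : ℝ) := by
    rw [hdiff, div_le_div_iff₀ (by positivity) (by positivity)]
    nlinarith [mul_le_mul c1 c2 kp.le p1.le]
  have hne : A2 - A1 ≠ 0 := by
    intro h
    rw [h, abs_zero] at w1
    have : 0 < 1 / (4 * (k : ℝ)) := by positivity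
    linarith
  refine ⟨min A1 A2, max A1 A2, (Z i2 j2 / n2 - Z i1 j1 / n1) / (A2 - A1),
    Z i1 j1 / n1 - (Z i2 j2 / n2 - Z i1 j1 / n1) / (A2 - A1) * A1, ?_, ?_, ?_⟩
  · have := max_sub_min_eq_abs A1 A2
    linarith
  · have := max_sub_min_eq_abs A1 A2
    linarith
  · intro t h h0 h4
    unfold edgePts gridPt
    simp only
    rw [seg_core j1 (-i1) (Z i1 j1) j2 (-i2) (Z i2 j2) s u t h hsR huR
      (by exact_mod_cast sj1) (by exact_mod_cast sj2) (by exact_mod_cast ui1)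
      (by exact_mod_cast ui2) n1 n2 hn1 hn2 p1 p2 h0 h4]
    constructor
    · rintro ⟨μ, m0, m1, ht, hh⟩
      have ht' : t = A1 + μ * (A2 - A1) := by rw [ht, hA1, hA2]; ring
      refine ⟨⟨?_, ?_⟩, ?_⟩
      · rcases le_total A1 A2 with q | q
        · rw [min_eq_left q]; nlinarith
        · rw [min_eq_right q]; nlinarith
      · rcases le_total A1 A2 with q | q
        · rw [max_eq_right q]; nlinarith
        · rw [max_eq_left q]; nlinarith
      · rw [ht', hh]; field_simp; ring
    · rintro ⟨⟨q1, q2⟩, hh⟩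
      refine ⟨(t - A1) / (A2 - A1), ?_, ?_, ?_, ?_⟩
      · rcases le_total A1 A2 with q | q
        · rw [min_eq_left q] at q1
          exact div_nonneg (by linarith) (by linarith)
        · rw [max_eq_left q] at q2
          exact div_nonneg_of_nonpos (by linarith) (by linarith)
      · rcases le_total A1 A2 with q | q
        · rw [max_eq_right q] at q2
          exact div_le_one_of_le₀ (by linarith) (by linarith)
        · rw [min_eq_right q] at q1
          exact div_le_one_of_ge (by linarith) (by linarith)
      · have : (t - A1) / (A2 - A1) * (A2 - A1) = t - A1 := div_mul_cancel₀ _ hne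
        have e : ∀ μ : ℝ, 2 + (u : ℝ) + u * ((1 - μ) * (j1 / n1) + μ * (j2 / n2))
          = A1 + μ * (A2 - A1) := by intro μ; rw [hA1, hA2]; ring
        rw [e, this]; ring
      · rw [hh]; field_simp; ring

/-- abstract top relation -/
def TopAt {ι : Type*} (E : Set ι) (a b α β : ι → ℝ) (e : ι) (u : ℝ) : Prop :=
  (a e ≤ u ∧ u ≤ b e) ∧ ∀ g ∈ E, a g ≤ u → u ≤ b g → α g * u + β g ≤ α e * u + β e

theorem germ_right {ι : Type*} (E : Set ι) (hE : E.Finite) (a b α β : ι → ℝ) (e : ι)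
    (t : ℝ) (ht : TopAt E a b α β e t) (htb : t < b e) (T : ℝ) (hT : t < T)
    (hno : ∀ v, t < v → v < T → ¬ ∀ u ∈ Set.Icc t v, TopAt E a b α β e u) :
    ∃ g ∈ E, TopAt E a b α β g t ∧ α g * t + β g = α e * t + β e ∧ α e < α g := by
  by_contra hcon
  push Not at hcon
  have h1 : ∀ g ∈ E, ∀ᶠ u in nhdsWithin t (Set.Ici t),
      (a g ≤ u → u ≤ b g → α g * u + β g ≤ α e * u + β e) := by
    intro g hg
    by_contra hf
    rw [Filter.not_eventually] at hf
    have hf' : ∃ᶠ u in nhdsWithin t (Set.Ici t),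
        (t ≤ u ∧ a g ≤ u ∧ u ≤ b g ∧ α e * u + β e < α g * u + β g) := by
      refine (hf.and_eventually self_mem_nhdsWithin).mono ?_
      rintro u ⟨hu, hu2⟩
      push Not at hu
      exact ⟨hu2, hu.1, hu.2.1, hu.2.2⟩
    have hn := hf'.filter_mono nhdsWithin_le_nhds
    have k1 : a g ≤ t := (isClosed_Ici (a := a g)).mem_of_frequently_of_tendsto
      (hn.mono fun u hu => hu.2.1) Filter.tendsto_id
    have k2 : t ≤ b g := (isClosed_Iic (a := b g)).mem_of_frequently_of_tendsto
      (hn.mono fun u hu => hu.2.2.1) Filter.tendsto_id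
    have k3 : α e * t + β e ≤ α g * t + β g :=
      (isClosed_le (f := fun u => α e * u + β e) (g := fun u => α g * u + β g)
        (by fun_prop) (by fun_prop)).mem_of_frequently_of_tendsto
      (hn.mono fun u hu => hu.2.2.2.le) Filter.tendsto_id
    have k4 := ht.2 g hg k1 k2
    have k5 : α g * t + β g = α e * t + β e := le_antisymm k4 k3
    obtain ⟨u, hu1, -, -, hu2⟩ := hf'.exists
    have := hcon g hg ⟨⟨k1, k2⟩, fun g' hg' x y => by rw [k5]; exact ht.2 g' hg' x y⟩ k5
    nlinarith
  have h2 := (Filter.eventually_all_finite hE).2 h1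
  have h3 : ∀ᶠ u in nhdsWithin t (Set.Ici t), u < T :=
    nhdsWithin_le_nhds (Iio_mem_nhds hT)
  have h4 : ∀ᶠ u in nhdsWithin t (Set.Ici t), u < b e :=
    nhdsWithin_le_nhds (Iio_mem_nhds htb)
  obtain ⟨v, hv, hsub⟩ := (mem_nhdsGE_iff_exists_Icc_subset).1 (h2.and (h3.and h4))
  have hv' : t < v := hv
  refine hno v hv' (hsub ⟨hv'.le, le_rfl⟩).2.1 ?_
  intro u hu
  have := hsub hu
  exact ⟨⟨ht.1.1.trans hu.1, this.2.2.le⟩, this.1⟩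

theorem germ_left {ι : Type*} (E : Set ι) (hE : E.Finite) (a b α β : ι → ℝ) (e : ι)
    (t : ℝ) (ht : TopAt E a b α β e t) (hta : a e < t) (T : ℝ) (hT : T < t)
    (hno : ∀ v, v < t → T < v → ¬ ∀ u ∈ Set.Icc v t, TopAt E a b α β e u) :
    ∃ g ∈ E, TopAt E a b α β g t ∧ α g * t + β g = α e * t + β e ∧ α g < α e := by
  have refl : ∀ x u, TopAt E (fun i => - b i) (fun i => - a i) (fun i => - α i) β x (-u) ↔
      TopAt E a b α β x u := by
    intro x u
    unfold TopAt
    simp only [neg_le_neg_iff, neg_mul_neg]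
    constructor
    · rintro ⟨⟨h1, h2⟩, h3⟩
      exact ⟨⟨h2, h1⟩, fun g hg p q => h3 g hg q p⟩
    · rintro ⟨⟨h1, h2⟩, h3⟩
      exact ⟨⟨h2, h1⟩, fun g hg p q => h3 g hg q p⟩
  obtain ⟨g, hg, h1, h2, h3⟩ := germ_right E hE (fun i => - b i) (fun i => - a i)
    (fun i => - α i) β e (-t) ((refl _ _).2 ht) (neg_lt_neg hta) (-T) (neg_lt_neg hT) (by
      intro v hv1 hv2 hall
      refine hno (-v) (by linarith) (by linarith) ?_
      intro u hu
      rw [← refl]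
      exact hall _ ⟨by linarith [hu.2], by linarith [hu.1]⟩)
  exact ⟨g, hg, (refl _ _).1 h1, by simpa using h2, by simpa using h3⟩

theorem nested_sup (I J : Set ℝ) (hI : I.OrdConnected) (hJ : J.OrdConnected)
    (nI : I.Nonempty) (nJ : J.Nonempty) (bI : BddAbove I) (bJ : BddAbove J)
    (hs : sSup I = sSup J) (hm : sSup I ∈ I ↔ sSup J ∈ J) : I ⊆ J ∨ J ⊆ I := by
  have main : ∀ I J : Set ℝ, I.OrdConnected → I.Nonempty → BddAbove J →
      sSup I = sSup J → (sSup I ∈ I ↔ sSup J ∈ J) → ∀ x ∈ I, ∀ y ∈ J, x < y → y ∈ I := by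
    intro I J hI nI bJ hs hm x hx y hy hxy
    rcases (le_csSup bJ hy).eq_or_lt with h | h
    · rw [h, ← hs]; rw [h] at hy; exact hm.2 hy
    · rw [← hs] at h
      obtain ⟨z, hz, hyz⟩ := exists_lt_of_lt_csSup nI h
      exact hI.out hx hz ⟨hxy.le, hyz.le⟩
  by_contra hcon
  push Not at hcon
  obtain ⟨h1, h2⟩ := hcon
  obtain ⟨x, hx, hx'⟩ := Set.not_subset.1 h1
  obtain ⟨y, hy, hy'⟩ := Set.not_subset.1 h2
  rcases lt_trichotomy x y with h | h | h
  · exact hy' (main I J hI nI bJ hs hm x hx y hy h)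
  · exact hx' (h ▸ hy)
  · exact hx' (main J I hJ nJ bI hs.symm hm.symm y hy x hx h)

theorem nested_inf (I J : Set ℝ) (hI : I.OrdConnected) (hJ : J.OrdConnected)
    (nI : I.Nonempty) (nJ : J.Nonempty) (bI : BddBelow I) (bJ : BddBelow J)
    (hs : sInf I = sInf J) (hm : sInf I ∈ I ↔ sInf J ∈ J) : I ⊆ J ∨ J ⊆ I := by
  have main : ∀ I J : Set ℝ, I.OrdConnected → I.Nonempty → BddBelow J →
      sInf I = sInf J → (sInf I ∈ I ↔ sInf J ∈ J) → ∀ x ∈ I, ∀ y ∈ J, y < x → y ∈ I := by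
    intro I J hI nI bJ hs hm x hx y hy hxy
    rcases (csInf_le bJ hy).eq_or_lt with h | h
    · rw [← h, ← hs]; rw [← h] at hy; exact hm.2 hy
    · rw [← hs] at h
      obtain ⟨z, hz, hyz⟩ := exists_lt_of_csInf_lt nI h
      exact hI.out hz hx ⟨hyz.le, hxy.le⟩
  by_contra hcon
  push Not at hcon
  obtain ⟨h1, h2⟩ := hcon
  obtain ⟨x, hx, hx'⟩ := Set.not_subset.1 h1
  obtain ⟨y, hy, hy'⟩ := Set.not_subset.1 h2
  rcases lt_trichotomy x y with h | h | h
  · exact hx' (main J I hJ nJ bI hs.symm hm.symm y hy x hx h)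
  · exact hx' (h ▸ hy)
  · exact hy' (main I J hI nI bJ hs hm x hx y hy h)

/-- Counting an antichain of intervals whose sup or inf lies in a finite set. -/
theorem count_antichain (M : Set (Set ℝ)) (T : Finset ℝ)
    (h1 : ∀ I ∈ M, I.Nonempty ∧ I.OrdConnected ∧ BddAbove I ∧ BddBelow I)
    (h2 : ∀ I ∈ M, ∀ J ∈ M, I ⊆ J → I = J)
    (h3 : ∀ I ∈ M, sSup I ∈ T ∨ sInf I ∈ T) : M.Finite ∧ M.ncard ≤ 4 * T.card := by
  classical
  let F : Set ℝ → ℝ × Bool × Bool := fun I =>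
    if sSup I ∈ T then (sSup I, decide (sSup I ∈ I), true) else (sInf I, decide (sInf I ∈ I), false)
  let U : Finset (ℝ × Bool × Bool) := T ×ˢ (Finset.univ ×ˢ Finset.univ)
  have hU : U.card = 4 * T.card := by
    simp [U, Finset.card_product]; ring
  have hmap : Set.MapsTo F M (U : Set (ℝ × Bool × Bool)) := by
    intro I hI
    simp only [F, U]
    split_ifs with h
    · simp [h]; exact em _
    · simp [(h3 I hI).resolve_left h]; exact em _
  have hinj : Set.InjOn F M := by
    intro I hI J hJ hIJ
    obtain ⟨a1, a2, a3, a4⟩ := h1 I hI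
    obtain ⟨b1, b2, b3, b4⟩ := h1 J hJ
    simp only [F] at hIJ
    split_ifs at hIJ with p q q
    · simp only [Prod.mk.injEq, decide_eq_decide, and_true] at hIJ
      rcases nested_sup I J a2 b2 a1 b1 a3 b3 hIJ.1 hIJ.2 with h | h
      · exact h2 I hI J hJ h
      · exact (h2 J hJ I hI h).symm
    · simp at hIJ
    · simp at hIJ
    · simp only [Prod.mk.injEq, decide_eq_decide, and_true] at hIJ
      rcases nested_inf I J a2 b2 a1 b1 a4 b4 hIJ.1 hIJ.2 with h | h
      · exact h2 I hI J hJ h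
      · exact (h2 J hJ I hI h).symm
  have hfin : (U : Set (ℝ × Bool × Bool)).Finite := U.finite_toSet
  refine ⟨Set.Finite.of_injOn hmap hinj hfin, ?_⟩
  have := Set.ncard_le_ncard_of_injOn F hmap hinj hfin
  rwa [Set.ncard_coe_finset, hU] at this

theorem top_closure {ι : Type*} (E : Set ι) (a b α β : ι → ℝ) (e : ι) (I : Set ℝ) (t : ℝ)
    (hcl : t ∈ closure I) (ht : 0 < t) (hI : ∀ u ∈ I, 0 < u → TopAt E a b α β e u)
    (ha : ∀ g ∈ E, t ≠ a g) (hb : ∀ g ∈ E, t ≠ b g) : TopAt E a b α β e t := by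
  have hf : ∃ᶠ u in nhds t, TopAt E a b α β e u := by
    have h1 : ∃ᶠ u in nhds t, u ∈ I := mem_closure_iff_frequently.1 hcl
    have h2 : ∀ᶠ u in nhds t, 0 < u := Ioi_mem_nhds ht
    exact (h1.and_eventually h2).mono fun u hu => hI u hu.1 hu.2
  refine ⟨⟨?_, ?_⟩, ?_⟩
  · exact (isClosed_Ici (a := a e)).mem_of_frequently_of_tendsto
      (hf.mono fun u hu => hu.1.1) Filter.tendsto_id
  · exact (isClosed_Iic (a := b e)).mem_of_frequently_of_tendsto
      (hf.mono fun u hu => hu.1.2) Filter.tendsto_id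
  · intro g hg h1 h2
    have k1 : ∀ᶠ u in nhds t, a g < u := Ioi_mem_nhds (lt_of_le_of_ne h1 (ha g hg).symm)
    have k2 : ∀ᶠ u in nhds t, u < b g := Iio_mem_nhds (lt_of_le_of_ne h2 (hb g hg))
    exact (isClosed_le (f := fun u => α g * u + β g) (g := fun u => α e * u + β e)
        (by fun_prop) (by fun_prop)).mem_of_frequently_of_tendsto
      ((hf.and_eventually (k1.and k2)).mono fun u hu => hu.1.2 g hg hu.2.1.le hu.2.2.le)
      Filter.tendsto_id

open Classical in
/-- The finite set of charged azimuths. -/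
noncomputable def chargeSet {ι : Type*} (F : Finset ι) (a b α β : ι → ℝ) (w : ℝ) : Finset ℝ :=
  {0, 4} ∪ (F.image a ∪ (F.image b ∪
    ((F ×ˢ Finset.range 9).image (fun p =>
      sInf {u : ℝ | ⌊u / w⌋ = ⌊a p.1 / w⌋ + (p.2 : ℤ) ∧ TopAt (F : Set ι) a b α β p.1 u}) ∪
    (F ×ˢ Finset.range 9).image (fun p =>
      sSup {u : ℝ | ⌊u / w⌋ = ⌊a p.1 / w⌋ + (p.2 : ℤ) ∧ TopAt (F : Set ι) a b α β p.1 u}))))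

theorem chargeSet_card {ι : Type*} (F : Finset ι) (a b α β : ι → ℝ) (w : ℝ) :
    (chargeSet F a b α β w).card ≤ 2 + 20 * F.card := by
  classical
  unfold chargeSet
  refine (Finset.card_union_le _ _).trans ?_
  have h0 : ({0, 4} : Finset ℝ).card ≤ 2 := Finset.card_le_two
  have h1 : (F.image a).card ≤ F.card := Finset.card_image_le
  have h2 : (F.image b).card ≤ F.card := Finset.card_image_le
  have h3 : ∀ f : ι × ℕ → ℝ, ((F ×ˢ Finset.range 9).image f).card ≤ 9 * F.card := by
    intro f
    refine Finset.card_image_le.trans ?_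
    rw [Finset.card_product, Finset.card_range, mul_comm]
  have h4 := Finset.card_union_le (F.image a) (F.image b ∪
    ((F ×ˢ Finset.range 9).image (fun p =>
      sInf {u : ℝ | ⌊u / w⌋ = ⌊a p.1 / w⌋ + (p.2 : ℤ) ∧ TopAt (F : Set ι) a b α β p.1 u}) ∪
    (F ×ˢ Finset.range 9).image (fun p =>
      sSup {u : ℝ | ⌊u / w⌋ = ⌊a p.1 / w⌋ + (p.2 : ℤ) ∧ TopAt (F : Set ι) a b α β p.1 u})))
  have h5 := Finset.card_union_le (F.image b)
    ((F ×ˢ Finset.range 9).image (fun p =>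
      sInf {u : ℝ | ⌊u / w⌋ = ⌊a p.1 / w⌋ + (p.2 : ℤ) ∧ TopAt (F : Set ι) a b α β p.1 u}) ∪
    (F ×ˢ Finset.range 9).image (fun p =>
      sSup {u : ℝ | ⌊u / w⌋ = ⌊a p.1 / w⌋ + (p.2 : ℤ) ∧ TopAt (F : Set ι) a b α β p.1 u}))
  have h6 := Finset.card_union_le
    ((F ×ˢ Finset.range 9).image (fun p =>
      sInf {u : ℝ | ⌊u / w⌋ = ⌊a p.1 / w⌋ + (p.2 : ℤ) ∧ TopAt (F : Set ι) a b α β p.1 u}))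
    ((F ×ˢ Finset.range 9).image (fun p =>
      sSup {u : ℝ | ⌊u / w⌋ = ⌊a p.1 / w⌋ + (p.2 : ℤ) ∧ TopAt (F : Set ι) a b α β p.1 u}))
  have h7 := h3 (fun p =>
      sInf {u : ℝ | ⌊u / w⌋ = ⌊a p.1 / w⌋ + (p.2 : ℤ) ∧ TopAt (F : Set ι) a b α β p.1 u})
  have h8 := h3 (fun p =>
      sSup {u : ℝ | ⌊u / w⌋ = ⌊a p.1 / w⌋ + (p.2 : ℤ) ∧ TopAt (F : Set ι) a b α β p.1 u})
  omega

theorem offset_ex (a b w t : ℝ) (hw : 0 < w) (h1 : a ≤ t) (h2 : t ≤ b) (h3 : b ≤ a + 8 * w) :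
    ∃ i < 9, ⌊t / w⌋ = ⌊a / w⌋ + (i : ℕ) := by
  have k1 : ⌊a / w⌋ ≤ ⌊t / w⌋ := Int.floor_mono (by gcongr)
  have k2 : ⌊t / w⌋ ≤ ⌊a / w⌋ + 8 := by
    rw [← Int.floor_add_ofNat]
    refine Int.floor_mono ?_
    rw [div_le_iff₀ hw, add_mul, div_mul_cancel₀ _ hw.ne']
    have : ((OfNat.ofNat 8 : ℝ)) = 8 := rfl
    linarith
  exact ⟨(⌊t / w⌋ - ⌊a / w⌋).toNat, by omega, by omega⟩

theorem charge {ι : Type*} (F : Finset ι) (a b α β : ι → ℝ) (w : ℝ) (hw : 0 < w)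
    (hlo : ∀ g ∈ F, a g + w ≤ b g) (hhi : ∀ g ∈ F, b g ≤ a g + 8 * w)
    (I : Set ℝ) (nI : I.Nonempty) (bI : I ⊆ Set.Ico 0 4) (e : ι) (he : e ∈ F)
    (hI : ∀ u ∈ I, 0 < u → TopAt (F : Set ι) a b α β e u)
    (hR : 0 < sSup I → ∀ v, sSup I < v → v < 4 →
      ¬ ∀ u ∈ Set.Icc (sSup I) v, TopAt (F : Set ι) a b α β e u)
    (hL : sInf I < 4 → ∀ v, v < sInf I → 0 < v →
      ¬ ∀ u ∈ Set.Icc v (sInf I), TopAt (F : Set ι) a b α β e u) :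
    sSup I ∈ chargeSet F a b α β w ∨ sInf I ∈ chargeSet F a b α β w := by
  classical
  by_contra hcon
  push Not at hcon
  obtain ⟨c1, c2⟩ := hcon
  have bA : BddAbove I := ⟨4, fun x hx => (bI hx).2.le⟩
  have bB : BddBelow I := ⟨0, fun x hx => (bI hx).1⟩
  have clt := csSup_mem_closure nI bA
  have cls := csInf_mem_closure nI bB
  have hst : sInf I ≤ sSup I := csInf_le_csSup nI bB bA
  have ht4 : sSup I ≤ 4 := csSup_le nI fun x hx => (bI hx).2.le
  have hs0 : 0 ≤ sInf I := le_csInf nI fun x hx => (bI hx).1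
  generalize sSup I = t at *
  generalize sInf I = s at *
  unfold chargeSet at c1 c2
  simp only [Finset.mem_union, Finset.mem_insert, Finset.mem_singleton, Finset.mem_image,
    Finset.mem_product, Finset.mem_range, not_or, not_exists, not_and, Prod.forall] at c1 c2
  obtain ⟨⟨t0, t4⟩, ta, tb, tI, tS⟩ := c1
  obtain ⟨⟨s0, s4⟩, sa, sb, sI, sS⟩ := c2
  have hs0' : 0 < s := lt_of_le_of_ne hs0 (Ne.symm s0)
  have ht4' : t < 4 := lt_of_le_of_ne ht4 t4
  have topt : TopAt (F : Set ι) a b α β e t := top_closure _ a b α β e I t clt (by linarith) hI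
    (fun g hg h => ta g hg h.symm) (fun g hg h => tb g hg h.symm)
  have tops : TopAt (F : Set ι) a b α β e s := top_closure _ a b α β e I s cls hs0' hI
    (fun g hg h => sa g hg h.symm) (fun g hg h => sb g hg h.symm)
  have fl : ∀ u v : ℝ, ⌊u / w⌋ = ⌊v / w⌋ → (⌊v / w⌋ : ℝ) * w ≤ u ∧ u < (⌊v / w⌋ + 1) * w := by
    intro u v h
    rw [← h]
    constructor
    · rw [← le_div_iff₀ hw]; exact Int.floor_le _
    · rw [← div_lt_iff₀ hw]; exact Int.lt_floor_add_one _
  by_cases hcase : a e ≤ (⌊t / w⌋ : ℝ) * w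
  · obtain ⟨g, hg, hg1, hg2, hg3⟩ := germ_right (F : Set ι) F.finite_toSet a b α β e t topt
      (lt_of_le_of_ne topt.1.2 (fun h => tb e he h.symm)) 4 ht4' (hR (by linarith))
    obtain ⟨i, hi, hfi⟩ := offset_ex (a g) (b g) w t hw hg1.1.1 hg1.1.2 (hhi g hg)
    refine tI g i ⟨hg, hi⟩ (IsLeast.csInf_eq ⟨⟨hfi, hg1⟩, ?_⟩)
    rintro u ⟨hu1, hu2⟩
    by_contra hlt
    push Not at hlt
    have := fl u t (hu1.trans hfi.symm)
    have := hu2.2 e he (by linarith) (by linarith [topt.1.2])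
    nlinarith
  · push Not at hcase
    have hae : a e ≤ s := tops.1.1
    have hsame : ⌊t / w⌋ = ⌊s / w⌋ := by
      refine le_antisymm ?_ (Int.floor_mono (by gcongr))
      rw [Int.le_floor, le_div_iff₀ hw]
      linarith
    obtain ⟨g, hg, hg1, hg2, hg3⟩ := germ_left (F : Set ι) F.finite_toSet a b α β e s tops
      (lt_of_le_of_ne hae (fun h => sa e he h)) 0 hs0' (hL (by linarith))
    obtain ⟨i, hi, hfi⟩ := offset_ex (a g) (b g) w s hw hg1.1.1 hg1.1.2 (hhi g hg)
    refine sS g i ⟨hg, hi⟩ (IsGreatest.csSup_eq ⟨⟨hfi, hg1⟩, ?_⟩)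
    rintro u ⟨hu1, hu2⟩
    by_contra hlt
    push Not at hlt
    have := fl u t ((hu1.trans hfi.symm).trans hsame.symm)
    have := hlo e he
    have := hu2.2 e he (by linarith) (by nlinarith)
    nlinarith

theorem edges_finite (l : ℕ) (hl : 2 ≤ l) (E : Set ((ℤ × ℤ) × (ℤ × ℤ)))
    (hE : E = {e | ∃ k : ℕ, (l + 1) / 2 ≤ k ∧ k ≤ l ∧ IsLayerEdge k e}) :
    E.Finite ∧ E.ncard ≤ 81 * l ^ 2 := by
  classical
  let U : Finset ((ℤ × ℤ) × (ℤ × ℤ)) :=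
    (Finset.Icc (-(l : ℤ)) l ×ˢ Finset.Icc (-(l : ℤ)) l) ×ˢ
      (Finset.Icc (-1 : ℤ) 1 ×ˢ Finset.Icc (-1 : ℤ) 1)
  let G : (ℤ × ℤ) × (ℤ × ℤ) → (ℤ × ℤ) × (ℤ × ℤ) := fun e => (e.1, e.2 - e.1)
  have hU : U.card ≤ 81 * l ^ 2 := by
    simp only [U, Finset.card_product, Int.card_Icc]
    have : ((l : ℤ) + 1 - -(l : ℤ)).toNat = 2 * l + 1 := by omega
    have h3 : ((1 : ℤ) + 1 - -1).toNat = 3 := by decide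
    rw [this, h3]
    nlinarith
  have hmap : Set.MapsTo G E (U : Set _) := by
    intro e he
    rw [hE] at he
    obtain ⟨k, hk1, hk2, h1, h2, h3⟩ := he
    obtain ⟨⟨i1, j1⟩, ⟨i2, j2⟩⟩ := e
    simp only at h1 h2 h3
    simp only [G, U, Finset.coe_product, Set.mem_prod, Finset.coe_Icc, Set.mem_Icc, Prod.mk_sub_mk]
    refine ⟨⟨⟨?_, ?_⟩, ?_, ?_⟩, ⟨?_, ?_⟩, ?_, ?_⟩ <;> grind
  have hinj : Set.InjOn G E := by
    intro e _ f _ h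
    simp only [G, Prod.mk.injEq] at h
    obtain ⟨h1, h2⟩ := h
    rw [h1] at h2
    exact Prod.ext h1 (sub_left_injective h2)
  refine ⟨Set.Finite.of_injOn hmap hinj U.finite_toSet, ?_⟩
  have := Set.ncard_le_ncard_of_injOn G hmap hinj U.finite_toSet
  rw [Set.ncard_coe_finset] at this
  omega

theorem horizon_top (Z : ℤ → ℤ → ℝ) (E : Set ((ℤ × ℤ) × (ℤ × ℤ))) (hE : E.Finite)
    (a b α β : (ℤ × ℤ) × (ℤ × ℤ) → ℝ)
    (hint : ∀ e ∈ E, ∀ t h : ℝ, 0 < t → t < 4 →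
        ((∃ r ∈ edgePts Z e, azimuth r = t ∧ scrHeight r = h) ↔
          (a e ≤ t ∧ t ≤ b e) ∧ h = α e * t + β e))
    (e : (ℤ × ℤ) × (ℤ × ℤ)) (he : e ∈ E) (t : ℝ) (h0 : 0 < t) (h4 : t < 4) :
    (∃ r ∈ edgePts Z e, azimuth r = t ∧ scrHeight r = horizon Z E t) ↔
      TopAt E a b α β e t := by
  have hset : {h : ℝ | ∃ e ∈ E, ∃ r ∈ edgePts Z e, azimuth r = t ∧ scrHeight r = h} =
      {h : ℝ | ∃ e ∈ E, (a e ≤ t ∧ t ≤ b e) ∧ h = α e * t + β e} := by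
    ext h
    constructor
    · rintro ⟨g, hg, hr⟩
      exact ⟨g, hg, (hint g hg t h h0 h4).1 hr⟩
    · rintro ⟨g, hg, hr⟩
      exact ⟨g, hg, (hint g hg t h h0 h4).2 hr⟩
  have hfin : {h : ℝ | ∃ e ∈ E, (a e ≤ t ∧ t ≤ b e) ∧ h = α e * t + β e}.Finite := by
    refine (hE.image (fun e => α e * t + β e)).subset ?_
    rintro h ⟨g, hg, -, rfl⟩
    exact ⟨g, hg, rfl⟩
  rw [hint e he t _ h0 h4]
  unfold horizon
  rw [hset]
  constructor
  · rintro ⟨h1, h2⟩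
    refine ⟨h1, fun g hg p q => ?_⟩
    rw [← h2]
    exact le_csSup hfin.bddAbove ⟨g, hg, ⟨p, q⟩, rfl⟩
  · rintro ⟨h1, h2⟩
    refine ⟨h1, IsGreatest.csSup_eq ⟨⟨e, he, h1, rfl⟩, ?_⟩⟩
    rintro h ⟨g, hg, ⟨p, q⟩, rfl⟩
    exact h2 g hg p q

theorem ordConn_right (I : Set ℝ) (hI : I.OrdConnected) (nI : I.Nonempty) (bI : BddAbove I)
    (v : ℝ) : (I ∪ Set.Icc (sSup I) v).OrdConnected := by
  have key : ∀ x ∈ I, ∀ z, x ≤ z → z < sSup I → z ∈ I := by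
    intro x hx z h1 h2
    obtain ⟨y, hy, hzy⟩ := exists_lt_of_lt_csSup nI h2
    exact hI.out hx hy ⟨h1, hzy.le⟩
  refine ⟨?_⟩
  rintro x hx y hy z ⟨h1, h2⟩
  by_cases hz : z < sSup I
  · left
    rcases hx with hx | hx
    · exact key x hx z h1 hz
    · exact absurd hx.1 (by linarith)
  · push Not at hz
    rcases hy with hy | hy
    · left
      have : z = y := le_antisymm h2 ((le_csSup bI hy).trans hz)
      exact this ▸ hy
    · exact Or.inr ⟨hz, h2.trans hy.2⟩

theorem ordConn_left (I : Set ℝ) (hI : I.OrdConnected) (nI : I.Nonempty) (bI : BddBelow I)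
    (v : ℝ) : (I ∪ Set.Icc v (sInf I)).OrdConnected := by
  have key : ∀ x ∈ I, ∀ z, z ≤ x → sInf I < z → z ∈ I := by
    intro x hx z h1 h2
    obtain ⟨y, hy, hzy⟩ := exists_lt_of_csInf_lt nI h2
    exact hI.out hy hx ⟨hzy.le, h1⟩
  refine ⟨?_⟩
  rintro x hx y hy z ⟨h1, h2⟩
  by_cases hz : sInf I < z
  · left
    rcases hy with hy | hy
    · exact key y hy z h2 hz
    · exact absurd hy.2 (by linarith)
  · push Not at hz
    rcases hx with hx | hx
    · left
      have : z = x := le_antisymm (hz.trans (csInf_le bI hx)) h1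
      exact this ▸ hx
    · exact Or.inr ⟨hx.1.trans h1, hz⟩

/-- The horizon of the edges of the `l/2` outermost layers in a square region of
`l` layers around the viewpoint has complexity `O(l²)`. -/
theorem horizon_outer_layers_quadratic :
    ∃ C : ℕ, 0 < C ∧ ∀ l m : ℕ, 2 ≤ l → l ≤ m → ∀ Z : ℤ → ℤ → ℝ,
      {I : Set ℝ | MaxHorizonPiece Z
          {e | ∃ k : ℕ, (l + 1) / 2 ≤ k ∧ k ≤ l ∧ IsLayerEdge k e} I}.Finite ∧
      {I : Set ℝ | MaxHorizonPiece Z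
          {e | ∃ k : ℕ, (l + 1) / 2 ≤ k ∧ k ≤ l ∧ IsLayerEdge k e} I}.ncard
        ≤ C * l ^ 2 := by
  refine ⟨4 * (2 + 20 * 81), by norm_num, ?_⟩
  intro l m hl _ Z
  obtain ⟨E, hE⟩ : ∃ E : Set ((ℤ × ℤ) × (ℤ × ℤ)),
    E = {e | ∃ k : ℕ, (l + 1) / 2 ≤ k ∧ k ≤ l ∧ IsLayerEdge k e} := ⟨_, rfl⟩
  rw [← hE]
  obtain ⟨hfin, hcard⟩ := edges_finite l hl E hE
  have hlR : (2 : ℝ) ≤ l := by exact_mod_cast hl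
  have hall : ∀ e : (ℤ × ℤ) × (ℤ × ℤ), ∃ a b α β : ℝ, e ∈ E →
      a + 1 / (4 * l) ≤ b ∧ b ≤ a + 8 * (1 / (4 * l)) ∧
      ∀ t h : ℝ, 0 < t → t < 4 →
        ((∃ r ∈ edgePts Z e, azimuth r = t ∧ scrHeight r = h) ↔
          (a ≤ t ∧ t ≤ b) ∧ h = α * t + β) := by
    intro e
    by_cases he : e ∈ E
    · have he' := he
      rw [hE] at he'
      obtain ⟨k, hk1, hk2, hk⟩ := he'
      obtain ⟨a, b, α, β, h1, h2, h3⟩ := edge_interface Z k (by omega) e hk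
      have hk0 : (1 : ℝ) ≤ k := by
        have : 1 ≤ k := by omega
        exact_mod_cast this
      have hkl : (k : ℝ) ≤ l := by exact_mod_cast hk2
      have hkl2 : (l : ℝ) ≤ 2 * k := by
        have : l ≤ 2 * k := by omega
        exact_mod_cast this
      refine ⟨a, b, α, β, fun _ => ⟨?_, ?_, h3⟩⟩
      · have : 1 / (4 * (l : ℝ)) ≤ 1 / (4 * k) := by gcongr
        linarith
      · have : 1 / (k : ℝ) ≤ 8 * (1 / (4 * l)) := by
          rw [mul_one_div, div_le_div_iff₀ (by linarith) (by linarith)]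
          linarith
        linarith
    · exact ⟨0, 0, 0, 0, fun h => absurd h he⟩
  choose a b α β hall using hall
  have htop := horizon_top Z E hfin a b α β (fun e he => (hall e he).2.2)
  have hF : ((hfin.toFinset : Finset _) : Set ((ℤ × ℤ) × (ℤ × ℤ))) = E := hfin.coe_toFinset
  have hrange : ∀ I, HorizonPiece Z E I → I ⊆ Set.Ico 0 4 := by
    rintro I ⟨-, -, e, -, h⟩ t ht
    obtain ⟨r, -, rfl, -⟩ := h t ht
    exact azimuth_range r
  have hcnt := count_antichain {I : Set ℝ | MaxHorizonPiece Z E I}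
    (chargeSet hfin.toFinset a b α β (1 / (4 * l))) ?_ ?_ ?_
  · refine ⟨hcnt.1, hcnt.2.trans ?_⟩
    have h1 := chargeSet_card hfin.toFinset a b α β (1 / (4 * l))
    rw [← Set.ncard_eq_toFinset_card E hfin] at h1
    nlinarith
  · rintro I ⟨hI, -⟩
    have := hrange I hI
    exact ⟨hI.1, hI.2.1, ⟨4, fun x hx => (this hx).2.le⟩, ⟨0, fun x hx => (this hx).1⟩⟩
  · rintro I ⟨-, hI⟩ J ⟨hJ, -⟩ hIJ
    exact (hI J hJ hIJ).symm
  · rintro I ⟨hI, hmax⟩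
    have hsub := hrange I hI
    have bA : BddAbove I := ⟨4, fun x hx => (hsub hx).2.le⟩
    have bB : BddBelow I := ⟨0, fun x hx => (hsub hx).1⟩
    obtain ⟨nI, oI, e, he, hp⟩ := hI
    refine charge hfin.toFinset a b α β (1 / (4 * l)) (by positivity)
      (fun g hg => (hall g (hfin.mem_toFinset.1 hg)).1)
      (fun g hg => (hall g (hfin.mem_toFinset.1 hg)).2.1) I nI hsub e
      (hfin.mem_toFinset.2 he) ?_ ?_ ?_
    · intro u hu hu0
      rw [hF]
      exact (htop e he u hu0 (hsub hu).2).1 (hp u hu)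
    · intro h0 v hv hv4 htv
      rw [hF] at htv
      have hJ : HorizonPiece Z E (I ∪ Set.Icc (sSup I) v) := by
        refine ⟨nI.mono Set.subset_union_left, ordConn_right I oI nI bA v, e, he, ?_⟩
        rintro u (hu | hu)
        · exact hp u hu
        · exact (htop e he u (by linarith [hu.1]) (by linarith [hu.2])).2 (htv u hu)
      have := hmax _ hJ Set.subset_union_left
      have hvI : v ∈ I := by
        rw [← this]; exact Or.inr ⟨hv.le, le_rfl⟩
      linarith [le_csSup bA hvI]
    · intro h4 v hv hv0 htv
      rw [hF] at htv
      have hJ : HorizonPiece Z E (I ∪ Set.Icc v (sInf I)) := by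
        refine ⟨nI.mono Set.subset_union_left, ordConn_left I oI nI bB v, e, he, ?_⟩
        rintro u (hu | hu)
        · exact hp u hu
        · exact (htop e he u (by linarith [hu.1]) (by linarith [hu.2])).2 (htv u hu)
      have := hmax _ hJ Set.subset_union_left
      have hvI : v ∈ I := by
        rw [← this]; exact Or.inr ⟨le_rfl, hv.le⟩
      linarith [csInf_le bB hvI]
end

section
/- There is an absolute constant C such that the following holds for every integer l ≥ 1 and every assignment of real elevations to the grid points: if S is the set of all edges of layers 1 through l in a square region of l layers around the viewpoint, then the horizon of S has complexity at most C·l². -/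
open Filter Topology in
lemma slab_left {ι : Type*} (N : Finset ι) (D : ι → ℝ → Prop) (A B : ι → ℝ) (h : ℝ → ℝ)
    (a b : ℝ)
    (H1 : ∀ t, a < t → t < b → ∀ n ∈ N, D n t → A n + B n * t ≤ h t)
    (H2 : ∀ t, a < t → t < b → ∀ n ∈ N, D n t → ∃ m ∈ N, D m t ∧ A m + B m * t = h t)
    (H3 : ∀ n ∈ N, (∀ t s, a < s → s ≤ t → t < b → D n t → D n s) ∨
      (∀ t s, a < t → t ≤ s → s < b → D n t → D n s))
    (c : ι) (hcN : c ∈ N) (hc : ∀ t s, a < s → s ≤ t → t < b → D c t → D c s)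
    (I : Set ℝ) (β : ℝ) (hβ : IsLUB I β) (haβ : a < β) (hβb : β < b)
    (hIP : ∀ t ∈ I, a < t → t < b → D c t ∧ A c + B c * t = h t) :
    (∀ w, a < w → w < b → D c w → A c + B c * w = h w → w ≤ β) ∨
    (∃ e ∈ N, (∃ s, a < s ∧ s < b ∧ D e s) ∧
      IsGLB {w | a < w ∧ w < b ∧ D e w ∧ A e + B e * w = h w} β) ∨
    (∃ γ, β < γ ∧ γ < b ∧ ∀ t, β ≤ t → t < γ → D c t ∧ A c + B c * t = h t) := by
  by_cases hw : ∀ w, a < w → w < b → D c w → A c + B c * w = h w → w ≤ β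
  · exact Or.inl hw
  right
  push Not at hw
  obtain ⟨w, haw, hwb, hDw, -, hβw⟩ := hw
  have hDc : ∀ s, a < s → s ≤ w → D c s := fun s h1 h2 => hc w s h1 h2 hwb hDw
  by_cases hf : ∃ γ, β < γ ∧ γ ≤ w ∧ ∀ t, β < t → t < γ → A c + B c * t = h t
  · right
    obtain ⟨γ, h1, h2, h3⟩ := hf
    refine ⟨γ, h1, lt_of_le_of_lt h2 hwb, fun t ht1 ht2 => ⟨hDc t (by linarith) (by linarith), ?_⟩⟩
    rcases ht1.lt_or_eq with ht1 | rfl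
    · exact h3 t ht1 ht2
    refine le_antisymm (H1 _ haβ hβb c hcN (hDc _ haβ hβw.le)) ?_
    obtain ⟨m, hm, hDm, hmh⟩ := H2 _ haβ hβb c hcN (hDc _ haβ hβw.le)
    rw [← hmh]
    by_contra hlt
    push Not at hlt
    have hcont : ContinuousAt (fun t => (A m + B m * t) - (A c + B c * t)) β := by fun_prop
    have hev : ∀ᶠ t in 𝓝 β, 0 < (A m + B m * t) - (A c + B c * t) :=
      hcont.eventually (lt_mem_nhds (by linarith))
    obtain ⟨δ, hδ, hδ'⟩ := Metric.eventually_nhds_iff.1 hev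
    rcases H3 m hm with hl | hr
    · obtain ⟨p, hpI, hp⟩ := (lt_isLUB_iff hβ).1 (show max a (β - δ) < β by simp [haβ, hδ])
      have hpβ := hβ.1 hpI
      have hap : a < p := lt_of_le_of_lt (le_max_left _ _) hp
      have hdp : β - δ < p := lt_of_le_of_lt (le_max_right _ _) hp
      have := hδ' (y := p) (by rw [Real.dist_eq, abs_lt]; constructor <;> linarith)
      have h5 := H1 p hap (by linarith) m hm (hl β p hap hpβ hβb hDm)
      have h6 := (hIP p hpI hap (by linarith)).2
      linarith
    · obtain ⟨p, hp1, hp2⟩ := exists_between (show β < min γ (β + δ) by simp [h1, hδ])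
      have hpg : p < γ := lt_of_lt_of_le hp2 (min_le_left _ _)
      have hpd : p < β + δ := lt_of_lt_of_le hp2 (min_le_right _ _)
      have := hδ' (y := p) (by rw [Real.dist_eq, abs_lt]; constructor <;> linarith)
      have h5 := H1 p (by linarith) (by linarith) m hm (hr β p haβ hp1.le (by linarith) hDm)
      have h6 := h3 p hp1 hpg
      linarith
  left
  push Not at hf
  have key : ∃ e ∈ N, ∀ γ, β < γ → γ ≤ w → ∃ s, β < s ∧ s < γ ∧ D e s ∧
      A e + B e * s = h s ∧ A c + B c * s < h s := by
    by_contra hcon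
    push Not at hcon
    have h1 : ∀ e ∈ N, ∀ᶠ s in 𝓝[>] β, ¬ (D e s ∧
      A e + B e * s = h s ∧ A c + B c * s < h s) := by
      intro e he
      obtain ⟨γ, hγ, -, h2⟩ := hcon e he
      filter_upwards [Ioo_mem_nhdsGT hγ] with s hs
      rintro ⟨h3, h4, h5⟩
      exact absurd h5 (not_lt.2 (h2 s hs.1 hs.2 h3 h4))
    have h2 := (Filter.eventually_all_finset N).2 h1
    obtain ⟨γ, hγ, hγ'⟩ := (mem_nhdsGT_iff_exists_Ioo_subset).1 h2
    obtain ⟨t, ht1, ht2, ht3⟩ := hf (min γ w) (lt_min hγ hβw) (min_le_right _ _)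
    have htw : t < w := lt_of_lt_of_le ht2 (min_le_right _ _)
    have hat : a < t := by linarith
    have hDt := hDc t hat htw.le
    obtain ⟨m, hm, hDm, hmh⟩ := H2 t hat (by linarith) c hcN hDt
    have hlt := lt_of_le_of_ne (H1 t hat (by linarith) c hcN hDt) ht3
    exact hγ' ⟨ht1, lt_of_lt_of_le ht2 (min_le_left _ _)⟩ m hm ⟨hDm, hmh, hlt⟩
  obtain ⟨e, he, hes⟩ := key
  obtain ⟨s, hs1, hs2, hs3, hs4, hs5⟩ := hes w hβw le_rfl
  refine ⟨e, he, ⟨s, by linarith, by linarith, hs3⟩, ?_, ?_⟩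
  · rintro v ⟨hv1, hv2, hv3, hv4⟩
    by_contra hvβ
    push Not at hvβ
    obtain ⟨p, hpI, hp⟩ := (lt_isLUB_iff hβ).1 hvβ
    have hpβ := hβ.1 hpI
    have hDp : D e p := by
      rcases H3 e he with hl | hr
      · exact hl s p (by linarith) (by linarith) (by linarith) hs3
      · exact hr v p hv1 hp.le (by linarith) hv3
    have h1 := H1 p (by linarith) (by linarith) e he hDp
    have h2 := (hIP p hpI (by linarith) (by linarith)).2
    have h3 := H1 v hv1 hv2 c hcN (hDc v hv1 (by linarith))
    have h4 : (B e - B c) * (p - v) ≤ 0 := by linarith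
    have h5 : 0 < (B e - B c) * (s - p) := by linarith
    have h6 : 0 < B e - B c := by
      rcases pos_and_pos_or_neg_and_neg_of_mul_pos h5 with h | h
      · exact h.1
      · linarith [h.2]
    have := mul_pos h6 (sub_pos.2 hp)
    linarith
  · intro m hm
    by_contra hlt
    push Not at hlt
    obtain ⟨s', hs1', hs2', hs3', hs4', hs5'⟩ := hes (min m w) (lt_min hlt hβw) (min_le_right _ _)
    have h1 : s' < m := lt_of_lt_of_le hs2' (min_le_left _ _)
    have h2 : s' < w := lt_of_lt_of_le hs2' (min_le_right _ _)
    have := hm (show s' ∈ _ from ⟨by linarith, by linarith, hs3', hs4'⟩)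
    linarith

lemma slab_right {ι : Type*} (N : Finset ι) (D : ι → ℝ → Prop) (A B : ι → ℝ) (h : ℝ → ℝ)
    (a b : ℝ)
    (H1 : ∀ t, a < t → t < b → ∀ n ∈ N, D n t → A n + B n * t ≤ h t)
    (H2 : ∀ t, a < t → t < b → ∀ n ∈ N, D n t → ∃ m ∈ N, D m t ∧ A m + B m * t = h t)
    (H3 : ∀ n ∈ N, (∀ t s, a < s → s ≤ t → t < b → D n t → D n s) ∨
      (∀ t s, a < t → t ≤ s → s < b → D n t → D n s))
    (c : ι) (hcN : c ∈ N) (hc : ∀ t s, a < t → t ≤ s → s < b → D c t → D c s)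
    (I : Set ℝ) (β : ℝ) (hβ : IsGLB I β) (haβ : a < β) (hβb : β < b)
    (hIP : ∀ t ∈ I, a < t → t < b → D c t ∧ A c + B c * t = h t) :
    (∀ w, a < w → w < b → D c w → A c + B c * w = h w → β ≤ w) ∨
    (∃ e ∈ N, (∃ s, a < s ∧ s < b ∧ D e s) ∧
      IsLUB {w | a < w ∧ w < b ∧ D e w ∧ A e + B e * w = h w} β) ∨
    (∃ γ, γ < β ∧ a < γ ∧ ∀ t, t ≤ β → γ < t → D c t ∧ A c + B c * t = h t) := by
  have := slab_left N (fun n t => D n (-t)) A (fun n => - B n) (fun t => h (-t)) (-b) (-a)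
    (fun t h1 h2 n hn hd => by
      have := H1 (-t) (by linarith) (by linarith) n hn hd
      linarith)
    (fun t h1 h2 n hn hd => by
      obtain ⟨m, hm, h3, h4⟩ := H2 (-t) (by linarith) (by linarith) n hn hd
      exact ⟨m, hm, h3, by linarith⟩)
    (fun n hn => (H3 n hn).symm.imp
      (fun hh t s h1 h2 h3 hd => hh (-t) (-s) (by linarith) (by linarith) (by linarith) hd)
      (fun hh t s h1 h2 h3 hd => hh (-t) (-s) (by linarith) (by linarith) (by linarith) hd))
    c hcN
    (fun t s h1 h2 h3 hd => hc (-t) (-s) (by linarith) (by linarith) (by linarith) hd)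
    (-I) (-β) hβ.neg (by linarith) (by linarith)
    (fun t ht h1 h2 => by
      have := hIP (-t) ht (by linarith) (by linarith)
      exact ⟨this.1, by linarith [this.2]⟩)
  rcases this with h1 | ⟨e, he, ⟨s, hs1, hs2, hs3⟩, hg⟩ | ⟨γ, h1, h2, h3⟩
  · left
    intro w hw1 hw2 hw3 hw4
    have := h1 (-w) (by linarith) (by linarith) (by simpa using hw3) (by simpa using hw4)
    linarith
  · right; left
    refine ⟨e, he, ⟨-s, by linarith, by linarith, hs3⟩, ?_⟩
    have := hg.neg
    rw [neg_neg] at this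
    have heq : {w | a < w ∧ w < b ∧ D e w ∧ A e + B e * w = h w} =
        -{w | -b < w ∧ w < -a ∧ D e (-w) ∧ A e + -B e * w = h (-w)} := by
      apply Set.ext
      intro w
      constructor
      · rintro ⟨h1, h2, h3, h4⟩
        exact ⟨by linarith, by linarith, by simpa using h3, by simpa using h4⟩
      · rintro ⟨h1, h2, h3, h4⟩
        exact ⟨by linarith, by linarith, by simpa using h3, by simpa using h4⟩
    rw [heq]
    exact this
  · right; right
    refine ⟨-γ, by linarith, by linarith, fun t ht1 ht2 => ?_⟩
    have := h3 (-t) (by linarith) (by linarith)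
    simpa using this

lemma antichain_sup {M : Set ℝ → Prop} (hM : ∀ I, M I → I.OrdConnected)
    (hA : ∀ I J, M I → M J → I ⊆ J → J = I) {I J : Set ℝ} (hI : M I) (hJ : M J) {β : ℝ}
    (h1 : IsLUB I β) (h2 : IsLUB J β) (h3 : β ∈ I ↔ β ∈ J) : I = J := by
  by_cases hs : I ⊆ J
  · exact (hA I J hI hJ hs).symm
  · apply hA J I hJ hI
    obtain ⟨x, hx, hxJ⟩ := Set.not_subset.1 hs
    have hxβ : x < β := lt_of_le_of_ne (h1.1 hx) (by rintro rfl; exact hxJ (h3.1 hx))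
    intro y hy
    have hxy : x ≤ y := by
      by_contra hlt
      push Not at hlt
      obtain ⟨z, hz, hxz⟩ := (lt_isLUB_iff h2).1 hxβ
      exact hxJ ((hM J hJ).out hy hz ⟨hlt.le, hxz.le⟩)
    rcases (h2.1 hy).lt_or_eq with hyβ | rfl
    · obtain ⟨z, hz, hxz⟩ := (lt_isLUB_iff h1).1 hyβ
      exact (hM I hI).out hx hz ⟨hxy, hxz.le⟩
    · exact h3.2 hy

lemma antichain_inf {M : Set ℝ → Prop} (hM : ∀ I, M I → I.OrdConnected)
    (hA : ∀ I J, M I → M J → I ⊆ J → J = I) {I J : Set ℝ} (hI : M I) (hJ : M J) {β : ℝ}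
    (h1 : IsGLB I β) (h2 : IsGLB J β) (h3 : β ∈ I ↔ β ∈ J) : I = J := by
  by_cases hs : I ⊆ J
  · exact (hA I J hI hJ hs).symm
  · apply hA J I hJ hI
    obtain ⟨x, hx, hxJ⟩ := Set.not_subset.1 hs
    have hxβ : β < x := lt_of_le_of_ne (h1.1 hx) (by rintro rfl; exact hxJ (h3.1 hx))
    intro y hy
    have hxy : y ≤ x := by
      by_contra hlt
      push Not at hlt
      obtain ⟨z, hz, hxz⟩ := (isGLB_lt_iff h2).1 hxβ
      exact hxJ ((hM J hJ).out hz hy ⟨hxz.le, hlt.le⟩)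
    rcases (h2.1 hy).lt_or_eq with hyβ | rfl
    · obtain ⟨z, hz, hxz⟩ := (isGLB_lt_iff h1).1 hyβ
      exact (hM I hI).out hz hx ⟨hxz.le, hxy⟩
    · exact h3.2 hy

open Classical in
lemma antichain_count {M : Set ℝ → Prop} (hM : ∀ I, M I → I.OrdConnected)
    (hne : ∀ I, M I → I.Nonempty) (hb : ∀ I, M I → BddAbove I ∧ BddBelow I)
    (hA : ∀ I J, M I → M J → I ⊆ J → J = I) (F : Finset ℝ)
    (hF : ∀ I, M I → sSup I ∈ F ∨ sInf I ∈ F) :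
    {I | M I}.Finite ∧ {I | M I}.ncard ≤ 4 * F.card := by
  let Φ : Set ℝ → Bool × ℝ × Bool := fun I =>
    if sSup I ∈ F then (true, sSup I, decide (sSup I ∈ I)) else (false, sInf I, decide (sInf I ∈ I))
  let T : Finset (Bool × ℝ × Bool) := Finset.univ ×ˢ F ×ˢ Finset.univ
  have hT : T.card = 4 * F.card := by
    simp [T, Finset.card_product]; ring
  have hmaps : Set.MapsTo Φ {I | M I} (T : Set _) := by
    intro I hI
    simp only [Φ, T]
    split_ifs with h
    · simp [h, Classical.em]
    · simp [(hF I hI).resolve_left h, Classical.em]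
  have hinj : Set.InjOn Φ {I | M I} := by
    intro I hI J hJ h
    simp only [Φ] at h
    split_ifs at h with h1 h2 h2
    · simp only [Prod.mk.injEq, decide_eq_decide, true_and] at h
      refine antichain_sup hM hA hI hJ (isLUB_csSup (hne I hI) (hb I hI).1) ?_ ?_
      · rw [h.1]; exact (isLUB_csSup (hne J hJ) (hb J hJ).1)
      · rw [h.2, h.1]
    · simp at h
    · simp at h
    · simp only [Prod.mk.injEq, decide_eq_decide, true_and] at h
      refine antichain_inf hM hA hI hJ (isGLB_csInf (hne I hI) (hb I hI).2) ?_ ?_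
      · rw [h.1]; exact (isGLB_csInf (hne J hJ) (hb J hJ).2)
      · rw [h.2, h.1]
  have hfin : {I | M I}.Finite := Set.Finite.of_injOn hmaps hinj T.finite_toSet
  refine ⟨hfin, ?_⟩
  rw [← hT, ← Set.ncard_coe_finset]
  exact Set.ncard_le_ncard_of_injOn Φ hmaps hinj T.finite_toSet

def oA : Fin 4 → Bool → ℤ
  | 0, true => 1 | 0, false => 0 | 1, true => 0 | 1, false => -1
  | 2, true => -1 | 2, false => 0 | 3, true => 0 | 3, false => 1
def oB : Fin 4 → Bool → ℤ
  | 0, true => 0 | 0, false => 1 | 1, true => -1 | 1, false => 0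
  | 2, true => 0 | 2, false => -1 | 3, true => 1 | 3, false => 0
def oC : Fin 4 → Bool → ℤ
  | 0, true => 0 | 0, false => -1 | 1, true => -1 | 1, false => 0
  | 2, true => 0 | 2, false => 1 | 3, true => 1 | 3, false => 0
def oD : Fin 4 → Bool → ℤ
  | 0, true => -1 | 0, false => 0 | 1, true => 0 | 1, false => -1
  | 2, true => 1 | 2, false => 0 | 3, true => 0 | 3, false => 1

abbrev OIdx := Fin 4 × Bool × ℕ × ℕ

def oE (n : OIdx) : (ℤ × ℤ) × (ℤ × ℤ) :=
  ((-(oC n.1 n.2.1 * n.2.2.1 + oD n.1 n.2.1 * n.2.2.2),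
    oA n.1 n.2.1 * n.2.2.1 + oB n.1 n.2.1 * n.2.2.2),
   (-(oC n.1 n.2.1 * n.2.2.1 + oD n.1 n.2.1 * (n.2.2.2 + 1)),
    oA n.1 n.2.1 * n.2.2.1 + oB n.1 n.2.1 * (n.2.2.2 + 1)))

noncomputable def oPt (q : Fin 4) (s : Bool) (k y z : ℝ) : ℝ × ℝ × ℝ :=
  (oA q s * k + oB q s * y, oC q s * k + oD q s * y, z)

noncomputable def cen (q : Fin 4) (s : Bool) : ℝ := (q.val : ℝ) + if s then 0 else 1
noncomputable def sg (s : Bool) : ℝ := if s then 1 else -1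
noncomputable def tau (k j : ℕ) : ℝ := (j : ℝ) / ((k : ℝ) + j)

def oDom (n : OIdx) (t : ℝ) : Prop :=
  tau n.2.2.1 n.2.2.2 ≤ sg n.2.1 * (t - cen n.1 n.2.1) ∧
  sg n.2.1 * (t - cen n.1 n.2.1) ≤ tau n.2.2.1 (n.2.2.2 + 1)

lemma oPt_az (q : Fin 4) (s : Bool) (k y z : ℝ) (hk : 0 < k) (hy : 0 ≤ y)
    (h : ¬ (q = 3 ∧ s = false ∧ y = 0)) :
    azimuth (oPt q s k y z) = cen q s + sg s * (y / (k + y)) := by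
  have hky : k + y ≠ 0 := by positivity
  have hq : ¬ k ≤ 0 := by linarith
  fin_cases q <;> cases s <;>
    simp [azimuth, oPt, oA, oB, oC, oD, cen, sg, abs_of_nonneg hy, abs_of_pos hk, hk.le, hy, hq] at h ⊢
  all_goals try split_ifs
  all_goals try (have hy0 : y = 0 := by first | exact le_antisymm (by assumption) hy | linarith)
  all_goals try (exfalso; exact h hy0)
  all_goals try subst hy0
  all_goals field_simp
  all_goals ring

lemma oPt_az_bad (k z : ℝ) (hk : 0 < k) :
    azimuth (oPt 3 false k 0 z) = 0 := by
  have hky : k ≠ 0 := by positivity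
  simp [azimuth, oPt, oA, oB, oC, oD, abs_of_pos hk, hky]

lemma oPt_h (q : Fin 4) (s : Bool) (k y z : ℝ) (hk : 0 < k) (hy : 0 ≤ y) :
    scrHeight (oPt q s k y z) = z / (k + y) := by
  fin_cases q <;> cases s <;>
    simp [scrHeight, oPt, oA, oB, oC, oD, abs_of_nonneg hy, abs_of_pos hk, add_comm]

noncomputable def oZ0 (Z : ℤ → ℤ → ℝ) (n : OIdx) : ℝ := Z (oE n).1.1 (oE n).1.2
noncomputable def oZ1 (Z : ℤ → ℤ → ℝ) (n : OIdx) : ℝ := Z (oE n).2.1 (oE n).2.2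

lemma oE_pts (Z : ℤ → ℤ → ℝ) (n : OIdx) (r : ℝ × ℝ × ℝ) :
    r ∈ edgePts Z (oE n) ↔ ∃ θ : ℝ, 0 ≤ θ ∧ θ ≤ 1 ∧
      r = oPt n.1 n.2.1 n.2.2.1 (n.2.2.2 + θ) (oZ0 Z n + θ * (oZ1 Z n - oZ0 Z n)) := by
  rw [edgePts, segment_eq_image']
  simp only [Set.mem_image, Set.mem_Icc]
  apply exists_congr
  intro θ
  rw [and_assoc]
  refine and_congr_right fun _ => and_congr_right fun _ => ?_
  rw [eq_comm]
  have : gridPt Z (oE n).1.1 (oE n).1.2 + θ • (gridPt Z (oE n).2.1 (oE n).2.2 - gridPt Z (oE n).1.1 (oE n).1.2)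
     = oPt n.1 n.2.1 n.2.2.1 (n.2.2.2 + θ) (oZ0 Z n + θ * (oZ1 Z n - oZ0 Z n)) := by
    simp only [gridPt, oPt, oZ0, oZ1, Prod.mk_sub_mk, Prod.smul_mk, Prod.mk_add_mk, smul_eq_mul, Prod.mk.injEq]
    refine ⟨?_, ?_, trivial⟩ <;> simp only [oE] <;> push_cast <;> ring
  rw [this]

/-- slope in local coordinate -/
noncomputable def locA (Z : ℤ → ℤ → ℝ) (n : OIdx) : ℝ :=
  (oZ0 Z n - n.2.2.2 * (oZ1 Z n - oZ0 Z n)) / n.2.2.1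
noncomputable def locB (Z : ℤ → ℤ → ℝ) (n : OIdx) : ℝ :=
  (oZ1 Z n - oZ0 Z n) - locA Z n
noncomputable def gA (Z : ℤ → ℤ → ℝ) (n : OIdx) : ℝ :=
  locA Z n - locB Z n * sg n.2.1 * cen n.1 n.2.1
noncomputable def gB (Z : ℤ → ℤ → ℝ) (n : OIdx) : ℝ := locB Z n * sg n.2.1

lemma sg_sq (s : Bool) : sg s * sg s = 1 := by cases s <;> simp [sg]

lemma oE_iface (Z : ℤ → ℤ → ℝ) (n : OIdx) (hk : 1 ≤ n.2.2.1) (t h : ℝ) (ht0 : 0 < t) (ht4 : t < 4) :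
    (∃ r ∈ edgePts Z (oE n), azimuth r = t ∧ scrHeight r = h) ↔
      (oDom n t ∧ gA Z n + gB Z n * t = h) := by
  obtain ⟨q, s, k, j⟩ := n
  have hk0 : (0 : ℝ) < k := by exact_mod_cast hk
  have hj0 : (0 : ℝ) ≤ j := by positivity
  have hval : ∀ θ : ℝ, 0 ≤ θ → (t = cen q s + sg s * ((j + θ) / (k + (j + θ)))) →
      gA Z (q, s, k, j) + gB Z (q, s, k, j) * t =
       (oZ0 Z (q, s, k, j) + θ * (oZ1 Z (q, s, k, j) - oZ0 Z (q, s, k, j))) / (k + (j + θ)) := by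
    intro θ hθ ht
    have h1 : gA Z (q, s, k, j) + gB Z (q, s, k, j) * t =
        locA Z (q, s, k, j) + locB Z (q, s, k, j) * ((sg s * sg s) * ((j + θ) / (k + (j + θ)))) := by
      simp only [gA, gB]; rw [ht]; ring
    rw [h1, sg_sq]
    simp only [locB, locA]
    have : (k : ℝ) + (j + θ) ≠ 0 := by positivity
    field_simp
    ring
  constructor
  · rintro ⟨r, hr, haz, hh⟩
    obtain ⟨θ, h0, h1, rfl⟩ := (oE_pts Z _ r).1 hr
    simp only at haz hh ⊢
    have hbad : ¬ (q = 3 ∧ s = false ∧ (j : ℝ) + θ = 0) := by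
      rintro ⟨rfl, rfl, h3⟩
      rw [h3, oPt_az_bad _ _ hk0] at haz
      linarith
    rw [oPt_az _ _ _ _ _ hk0 (by positivity) hbad] at haz
    rw [oPt_h _ _ _ _ _ hk0 (by positivity)] at hh
    refine ⟨?_, by rw [hval θ h0 haz.symm, hh]⟩
    have h2 : sg s * (t - cen q s) = (j + θ) / (k + (j + θ)) := by
      rw [← haz]
      calc _ = (sg s * sg s) * ((j + θ) / (k + (j + θ))) := by ring
        _ = _ := by rw [sg_sq, one_mul]
    simp only [oDom, tau, h2]
    push_cast
    constructor
    · rw [div_le_div_iff₀ (by positivity) (by positivity)]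
      nlinarith
    · rw [div_le_div_iff₀ (by positivity) (by positivity)]
      nlinarith
  · rintro ⟨⟨h1, h2⟩, h3⟩
    simp only [tau] at h1 h2
    set τ := sg s * (t - cen q s) with hτ
    have ht : t = cen q s + sg s * τ := by
      rw [hτ, ← mul_assoc, sg_sq]; ring
    have hτ1 : τ < 1 := by
      refine lt_of_le_of_lt h2 ?_
      push_cast
      rw [div_lt_one (by positivity)]
      linarith
    have h1' : (0 : ℝ) < 1 - τ := by linarith
    have hθ0 : 0 ≤ k * τ / (1 - τ) - j := by
      rw [div_le_iff₀ (by positivity)] at h1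
      rw [sub_nonneg, le_div_iff₀ h1']
      nlinarith
    have hθ1 : k * τ / (1 - τ) - j ≤ 1 := by
      push_cast at h2
      rw [le_div_iff₀ (by positivity)] at h2
      rw [sub_le_iff_le_add, div_le_iff₀ h1']
      nlinarith
    have hτe : τ = (j + (k * τ / (1 - τ) - j)) / (k + (j + (k * τ / (1 - τ) - j))) := by
      have : (k : ℝ) + (j + (k * τ / (1 - τ) - j)) ≠ 0 := by positivity
      rw [eq_div_iff this]
      field_simp
      ring
    generalize hθ : k * τ / (1 - τ) - j = θ at *
    have haz : azimuth (oPt q s k (j + θ) (oZ0 Z (q, s, k, j) + θ * (oZ1 Z (q, s, k, j) - oZ0 Z (q, s, k, j)))) = t := by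
      rw [oPt_az _ _ _ _ _ hk0 (by positivity), ← hτe, ← ht]
      rintro ⟨rfl, rfl, h4⟩
      rw [h4] at hτe
      simp only [zero_div] at hτe
      rw [hτe] at ht
      norm_num [cen] at ht
      linarith
    refine ⟨_, (oE_pts Z _ _).2 ⟨θ, hθ0, hθ1, rfl⟩, haz, ?_⟩
    rw [oPt_h _ _ _ _ _ hk0 (by positivity), ← h3, hval θ hθ0]
    rw [← hτe, ← ht]

lemma oE_layer (n : OIdx) (hj : n.2.2.2 < n.2.2.1) : IsLayerEdge n.2.2.1 (oE n) := by
  obtain ⟨q, s, k, j⟩ := n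
  simp only at hj
  fin_cases q <;> cases s <;>
    simp [IsLayerEdge, oE, oA, oB, oC, oD] <;> grind

lemma layer_oE_up (k : ℕ) (a b c d : ℤ) (h1 : max |a| |b| = (k : ℤ)) (h2 : max |c| |d| = (k : ℤ))
    (h3 : (a = c ∧ d = b + 1) ∨ (b = d ∧ c = a + 1)) :
    ∃ q s j, j < k ∧ (((a, b), (c, d)) = oE (q, s, k, j) ∨ ((a, b), (c, d)) = (oE (q, s, k, j)).swap) := by
  have h4 : (a = c ∧ d = b + 1 ∧ (a = k ∨ a = -k) ∧ -(k : ℤ) ≤ b ∧ d ≤ k) ∨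
      (b = d ∧ c = a + 1 ∧ (b = k ∨ b = -k) ∧ -(k : ℤ) ≤ a ∧ c ≤ k) := by
    have ha := abs_cases a
    have hb := abs_cases b
    have hc := abs_cases c
    have hd := abs_cases d
    omega
  rcases h4 with ⟨rfl, rfl, h5, h6, h7⟩ | ⟨rfl, rfl, h5, h6, h7⟩
  · rcases h5 with rfl | rfl
    · rcases le_or_gt 0 b with hb | hb
      · obtain ⟨j, rfl⟩ := Int.eq_ofNat_of_zero_le hb
        refine ⟨0, false, j, by omega, Or.inl ?_⟩
        simp [oE, oA, oB, oC, oD]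
      · obtain ⟨j, hj⟩ := Int.eq_ofNat_of_zero_le (show 0 ≤ -b - 1 by omega)
        obtain rfl : b = -(j : ℤ) - 1 := by omega
        refine ⟨1, true, j, by omega, Or.inr ?_⟩
        simp [oE, oA, oB, oC, oD] ; try omega
    · rcases le_or_gt 0 b with hb | hb
      · obtain ⟨j, rfl⟩ := Int.eq_ofNat_of_zero_le hb
        refine ⟨3, true, j, by omega, Or.inl ?_⟩
        simp [oE, oA, oB, oC, oD]
      · obtain ⟨j, hj⟩ := Int.eq_ofNat_of_zero_le (show 0 ≤ -b - 1 by omega)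
        obtain rfl : b = -(j : ℤ) - 1 := by omega
        refine ⟨2, false, j, by omega, Or.inr ?_⟩
        simp [oE, oA, oB, oC, oD] ; try omega
  · rcases h5 with rfl | rfl
    · rcases le_or_gt 0 a with hb | hb
      · obtain ⟨j, rfl⟩ := Int.eq_ofNat_of_zero_le hb
        refine ⟨0, true, j, by omega, Or.inl ?_⟩
        simp [oE, oA, oB, oC, oD] ; try omega
      · obtain ⟨j, hj⟩ := Int.eq_ofNat_of_zero_le (show 0 ≤ -a - 1 by omega)
        obtain rfl : a = -(j : ℤ) - 1 := by omega
        refine ⟨3, false, j, by omega, Or.inr ?_⟩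
        simp [oE, oA, oB, oC, oD] ; try omega
    · rcases le_or_gt 0 a with hb | hb
      · obtain ⟨j, rfl⟩ := Int.eq_ofNat_of_zero_le hb
        refine ⟨1, false, j, by omega, Or.inl ?_⟩
        simp [oE, oA, oB, oC, oD] ; try omega
      · obtain ⟨j, hj⟩ := Int.eq_ofNat_of_zero_le (show 0 ≤ -a - 1 by omega)
        obtain rfl : a = -(j : ℤ) - 1 := by omega
        refine ⟨2, true, j, by omega, Or.inr ?_⟩
        simp [oE, oA, oB, oC, oD] ; try omega

lemma layer_oE (k : ℕ) (e : (ℤ × ℤ) × (ℤ × ℤ)) (he : IsLayerEdge k e) :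
    ∃ q s j, j < k ∧ (e = oE (q, s, k, j) ∨ e = (oE (q, s, k, j)).swap) := by
  obtain ⟨⟨a, b⟩, ⟨c, d⟩⟩ := e
  obtain ⟨h1, h2, h3⟩ := he
  simp only at h1 h2 h3
  have h4 : ((a = c ∧ d = b + 1) ∨ (b = d ∧ c = a + 1)) ∨ ((c = a ∧ b = d + 1) ∨ (d = b ∧ a = c + 1)) := by
    grind
  rcases h4 with h4 | h4
  · exact layer_oE_up k a b c d h1 h2 h4
  · obtain ⟨q, s, j, hj, h⟩ := layer_oE_up k c d a b h2 h1 h4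
    refine ⟨q, s, j, hj, ?_⟩
    rcases h with h | h
    · right; rw [← h]; rfl
    · left
      have := congrArg Prod.swap h
      rw [Prod.swap_swap] at this
      rw [← this]; rfl

lemma edgePts_swap (Z : ℤ → ℤ → ℝ) (e : (ℤ × ℤ) × (ℤ × ℤ)) : edgePts Z e.swap = edgePts Z e := by
  simp only [edgePts, Prod.fst_swap, Prod.snd_swap]
  exact segment_symm _ _ _

lemma tau_lt_iff {k l : ℕ} (hk : 1 ≤ k) (hl : 1 ≤ l) (j i : ℕ) :
    tau k j < tau l i ↔ j * l < i * k := by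
  have hk0 : (0 : ℝ) < k := by exact_mod_cast hk
  have hl0 : (0 : ℝ) < l := by exact_mod_cast hl
  rw [tau, tau, div_lt_div_iff₀ (by positivity) (by positivity)]
  rw [← @Nat.cast_lt ℝ]
  push_cast
  constructor <;> intro h <;> linarith

lemma tau_nonneg (k j : ℕ) : 0 ≤ tau k j := by unfold tau; positivity

lemma tau_le_half {k j : ℕ} (hk : 1 ≤ k) (hj : j ≤ k) : tau k j ≤ 1 / 2 := by
  have hk0 : (0 : ℝ) < k := by exact_mod_cast hk
  have hj0 : (j : ℝ) ≤ k := by exact_mod_cast hj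
  rw [tau, div_le_div_iff₀ (by positivity) (by positivity)]
  linarith

noncomputable def slA (l : ℕ) (q : Fin 4) (s : Bool) (i : ℕ) : ℝ :=
  if s then cen q s + tau l i else cen q s - tau l (i + 1)
noncomputable def slB (l : ℕ) (q : Fin 4) (s : Bool) (i : ℕ) : ℝ :=
  if s then cen q s + tau l (i + 1) else cen q s - tau l i

lemma slab_iff (l : ℕ) (q : Fin 4) (s : Bool) (i : ℕ) (t : ℝ) :
    (slA l q s i < t ∧ t < slB l q s i) ↔
      (tau l i < sg s * (t - cen q s) ∧ sg s * (t - cen q s) < tau l (i + 1)) := by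
  cases s <;> simp [slA, slB, sg] <;> constructor <;> rintro ⟨h1, h2⟩ <;> constructor <;> linarith

lemma oct_eq (q q' : Fin 4) (s s' : Bool) (t : ℝ)
    (h1 : 0 < sg s * (t - cen q s)) (h2 : sg s * (t - cen q s) < 1 / 2)
    (h3 : 0 ≤ sg s' * (t - cen q' s')) (h4 : sg s' * (t - cen q' s') ≤ 1 / 2) :
    q' = q ∧ s' = s := by
  have hh : ∀ (q : Fin 4) (s : Bool), 0 ≤ sg s * (t - cen q s) → sg s * (t - cen q s) ≤ 1/2 →
      (q.val : ℝ) ≤ t ∧ t ≤ q.val + 1 := by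
    intro q s h1 h2
    cases s <;> simp [sg, cen] at h1 h2 <;> constructor <;> linarith
  have hh' : (q.val : ℝ) < t ∧ t < q.val + 1 := by
    cases s <;> simp [sg, cen] at h1 h2 <;> constructor <;> linarith
  have hh2 := hh q' s' h3 h4
  have e1 : q.val < q'.val + 1 := by
    have : (q.val : ℝ) < (q'.val : ℝ) + 1 := by linarith
    exact_mod_cast this
  have e2 : q'.val < q.val + 1 := by
    have : (q'.val : ℝ) < (q.val : ℝ) + 1 := by linarith
    exact_mod_cast this
  have e3 : q' = q := Fin.ext (by omega)
  subst e3
  refine ⟨rfl, ?_⟩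
  cases s <;> cases s' <;> simp [sg, cen] at * <;> linarith

lemma slab_pos {l : ℕ} (hl : 1 ≤ l) (q : Fin 4) (s : Bool) {i : ℕ} (hi : i < l) (t : ℝ)
    (h1 : slA l q s i < t) (h2 : t < slB l q s i) : 0 < t ∧ t < 4 := by
  obtain ⟨h3, h4⟩ := (slab_iff l q s i t).1 ⟨h1, h2⟩
  have h5 := tau_nonneg l i
  have h6 := tau_le_half hl (show i + 1 ≤ l from hi)
  have h7 : (q.val : ℝ) ≤ 3 := by exact_mod_cast (show q.val ≤ 3 by omega)
  have h8 : (0 : ℝ) ≤ q.val := by positivity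
  cases s <;> simp [sg, cen] at h3 h4 <;> constructor <;> linarith

lemma slab_inc {l : ℕ} (hl : 1 ≤ l) (q : Fin 4) (s : Bool) {i : ℕ} (hi : i < l) (t : ℝ)
    (h1 : slA l q s i < t) (h2 : t < slB l q s i) (n : OIdx) (hk : 1 ≤ n.2.2.1) (hkl : n.2.2.1 ≤ l)
    (hj : n.2.2.2 < n.2.2.1) (hd : oDom n t) :
    n.1 = q ∧ n.2.1 = s ∧ (n.2.2.2 = i * n.2.2.1 / l ∨ n.2.2.2 = i * n.2.2.1 / l + 1) := by
  obtain ⟨q', s', k, j⟩ := n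
  simp only at *
  obtain ⟨h3, h4⟩ := (slab_iff l q s i t).1 ⟨h1, h2⟩
  obtain ⟨h5, h6⟩ := hd
  simp only at h5 h6
  have e1 := tau_nonneg l i
  have e2 := tau_le_half hl (show i + 1 ≤ l from hi)
  have e3 := tau_nonneg k j
  have e4 := tau_le_half hk (show j + 1 ≤ k from hj)
  obtain ⟨rfl, rfl⟩ := oct_eq q q' s s' t (by linarith) (by linarith) (by linarith) (by linarith)
  refine ⟨rfl, rfl, ?_⟩
  have f1 := (tau_lt_iff hk hl _ _).1 (lt_of_le_of_lt h5 h4)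
  have f2 := (tau_lt_iff hl hk _ _).1 (lt_of_lt_of_le h3 h6)
  have g1 : i * k / l < j + 1 := (Nat.div_lt_iff_lt_mul (by omega)).2 f2
  have g2 : j ≤ i * k / l + 1 := by
    by_contra hlt
    push Not at hlt
    have : i * k / l < j - 1 := by omega
    rw [Nat.div_lt_iff_lt_mul (by omega)] at this
    obtain ⟨m, rfl⟩ : ∃ m, j = m + 1 := ⟨j - 1, by
      have := lt_of_le_of_lt (Nat.zero_le _) hlt
      omega⟩
    simp at this
    nlinarith
  omega

lemma slab_LR {l : ℕ} (hl : 1 ≤ l) (q : Fin 4) (s : Bool) {i : ℕ} (hi : i < l)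
    (n : OIdx) (hk : 1 ≤ n.2.2.1) (hkl : n.2.2.1 ≤ l) (hj : n.2.2.2 < n.2.2.1) :
    (∀ t u, slA l q s i < u → u ≤ t → t < slB l q s i → oDom n t → oDom n u) ∨
      (∀ t u, slA l q s i < t → t ≤ u → u < slB l q s i → oDom n t → oDom n u) := by
  by_cases hq : n.1 = q ∧ n.2.1 = s
  swap
  · left
    intro t u h1 h2 h3 h4
    have := slab_inc hl q s hi t (by linarith) h3 n hk hkl hj h4
    exact absurd ⟨this.1, this.2.1⟩ hq
  obtain ⟨q', s', k, j⟩ := n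
  simp only at *
  obtain ⟨rfl, rfl⟩ := hq
  have hor : tau k j ≤ tau l i ∨ tau l (i + 1) ≤ tau k (j + 1) := by
    by_contra hcon
    push Not at hcon
    have f1 := (tau_lt_iff hl hk _ _).1 hcon.1
    have f2 := (tau_lt_iff hk hl _ _).1 hcon.2
    nlinarith
  have lowc : tau k j ≤ tau l i → ∀ t u, (slA l q' s' i < u ∧ u < slB l q' s' i) →
      sg s' * (u - cen q' s') ≤ sg s' * (t - cen q' s') → oDom (q', s', k, j) t → oDom (q', s', k, j) u := by
    intro h0 t u h1 h2 h3
    rw [slab_iff] at h1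
    exact ⟨by simp only; linarith [h1.1], le_trans h2 h3.2⟩
  have highc : tau l (i + 1) ≤ tau k (j + 1) → ∀ t u, (slA l q' s' i < u ∧ u < slB l q' s' i) →
      sg s' * (t - cen q' s') ≤ sg s' * (u - cen q' s') → oDom (q', s', k, j) t → oDom (q', s', k, j) u := by
    intro h0 t u h1 h2 h3
    rw [slab_iff] at h1
    exact ⟨le_trans h3.1 h2, by simp only; linarith [h1.2]⟩
  cases s'
  · rcases hor with h | h
    · right
      intro t u h1 h2 h3 h4
      exact lowc h t u ⟨by linarith, h3⟩ (by simp [sg]; linarith) h4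
    · left
      intro t u h1 h2 h3 h4
      exact highc h t u ⟨h1, by linarith⟩ (by simp [sg]; linarith) h4
  · rcases hor with h | h
    · left
      intro t u h1 h2 h3 h4
      exact lowc h t u ⟨h1, by linarith⟩ (by simp [sg]; linarith) h4
    · right
      intro t u h1 h2 h3 h4
      exact highc h t u ⟨by linarith, h3⟩ (by simp [sg]; linarith) h4

lemma slab_cover_loc {l : ℕ} (hl : 1 ≤ l) (τ : ℝ) (h0 : 0 ≤ τ) (h1 : τ ≤ 1 / 2) :
    (∃ i, i ≤ l ∧ τ = tau l i) ∨ (∃ i, i < l ∧ tau l i < τ ∧ τ < tau l (i + 1)) := by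
  have hl0 : (0 : ℝ) < l := by exact_mod_cast hl
  have hex : ∃ i, τ ≤ tau l i := ⟨l, by
    rw [tau, show (l : ℝ) / (l + l) = 1 / 2 by field_simp; ring]; exact h1⟩
  classical
  have hf := Nat.find_spec hex
  have hle : Nat.find hex ≤ l := Nat.find_min' hex (by
    rw [tau, show (l : ℝ) / (l + l) = 1 / 2 by field_simp; ring]; exact h1)
  rcases hf.eq_or_lt with h | h
  · exact Or.inl ⟨_, hle, h⟩
  · right
    rcases Nat.eq_zero_or_pos (Nat.find hex) with hz | hp
    · rw [hz] at h
      simp [tau] at h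
      linarith
    · obtain ⟨i, hi⟩ : ∃ i, Nat.find hex = i + 1 := ⟨Nat.find hex - 1, by omega⟩
      have := Nat.find_min hex (show i < Nat.find hex by omega)
      rw [hi] at h
      exact ⟨i, by omega, not_le.1 this, h⟩

lemma oct_cover (β : ℝ) (h0 : 0 ≤ β) (h4 : β ≤ 4) :
    ∃ (q : Fin 4) (s : Bool), 0 ≤ sg s * (β - cen q s) ∧ sg s * (β - cen q s) ≤ 1 / 2 := by
  have : ∃ q : Fin 4, (q.val : ℝ) ≤ β ∧ β ≤ q.val + 1 := by
    rcases le_total β 1 with h | h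
    · exact ⟨0, by norm_num; exact ⟨h0, h⟩⟩
    rcases le_total β 2 with h' | h'
    · exact ⟨1, by norm_num; constructor <;> linarith⟩
    rcases le_total β 3 with h'' | h''
    · exact ⟨2, by norm_num; constructor <;> linarith⟩
    · exact ⟨3, by norm_num; constructor <;> linarith⟩
  obtain ⟨q, h1, h2⟩ := this
  rcases le_total β (q.val + 1 / 2) with h | h
  · exact ⟨q, true, by simp [sg, cen]; constructor <;> linarith⟩
  · exact ⟨q, false, by simp [sg, cen]; constructor <;> linarith⟩

lemma slab_cover {l : ℕ} (hl : 1 ≤ l) (β : ℝ) (h0 : 0 ≤ β) (h4 : β ≤ 4) :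
    (∃ q s i, i ≤ l ∧ β = cen q s + sg s * tau l i) ∨
    (∃ q s i, i < l ∧ slA l q s i < β ∧ β < slB l q s i) := by
  obtain ⟨q, s, h1, h2⟩ := oct_cover β h0 h4
  rcases slab_cover_loc hl _ h1 h2 with ⟨i, hi, h⟩ | ⟨i, hi, h⟩
  · left
    refine ⟨q, s, i, hi, ?_⟩
    rw [← h, ← mul_assoc, sg_sq]; ring
  · right
    exact ⟨q, s, i, hi, (slab_iff _ _ _ _ _).2 h⟩

lemma azimuth_mem (r : ℝ × ℝ × ℝ) : 0 ≤ azimuth r ∧ azimuth r ≤ 4 := by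
  have h : |r.1 / (|r.1| + |r.2.1|)| ≤ 1 := by
    rw [abs_div, abs_of_nonneg (show 0 ≤ |r.1| + |r.2.1| by positivity)]
    apply div_le_one_of_le₀ _ (by positivity)
    linarith [abs_nonneg r.2.1]
  rw [abs_le] at h
  unfold azimuth
  split_ifs <;> constructor <;> linarith

def EE (l : ℕ) : Set ((ℤ × ℤ) × (ℤ × ℤ)) := {e | ∃ k : ℕ, 1 ≤ k ∧ k ≤ l ∧ IsLayerEdge k e}

def Ix (l : ℕ) : Finset OIdx :=
  (Finset.univ ×ˢ Finset.univ ×ˢ Finset.Icc 1 l ×ˢ Finset.range l).filter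
    (fun n => n.2.2.2 < n.2.2.1)

lemma mem_Ix (l : ℕ) (n : OIdx) :
    n ∈ Ix l ↔ 1 ≤ n.2.2.1 ∧ n.2.2.1 ≤ l ∧ n.2.2.2 < n.2.2.1 := by
  simp only [Ix, Finset.mem_filter, Finset.mem_product, Finset.mem_univ, Finset.mem_Icc,
    Finset.mem_range, true_and]
  omega

lemma oE_mem {l : ℕ} {n : OIdx} (hn : n ∈ Ix l) : oE n ∈ EE l := by
  obtain ⟨h1, h2, h3⟩ := (mem_Ix l n).1 hn
  exact ⟨_, h1, h2, oE_layer n h3⟩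

lemma EE_pts {l : ℕ} (Z : ℤ → ℤ → ℝ) {e : (ℤ × ℤ) × (ℤ × ℤ)} (he : e ∈ EE l) :
    ∃ n ∈ Ix l, edgePts Z e = edgePts Z (oE n) := by
  obtain ⟨k, h1, h2, h3⟩ := he
  obtain ⟨q, s, j, hj, h⟩ := layer_oE k e h3
  refine ⟨(q, s, k, j), (mem_Ix _ _).2 ⟨h1, h2, hj⟩, ?_⟩
  rcases h with rfl | rfl
  · rfl
  · exact edgePts_swap _ _

lemma hor_set (Z : ℤ → ℤ → ℝ) (l : ℕ) (t : ℝ) (h0 : 0 < t) (h4 : t < 4) :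
    {h : ℝ | ∃ e ∈ EE l, ∃ r ∈ edgePts Z e, azimuth r = t ∧ scrHeight r = h} =
    (fun n => gA Z n + gB Z n * t) '' {n | n ∈ Ix l ∧ oDom n t} := by
  apply Set.ext
  intro h
  constructor
  · rintro ⟨e, he, hr⟩
    obtain ⟨n, hn, hp⟩ := EE_pts Z he
    rw [hp, oE_iface Z n ((mem_Ix l n).1 hn).1 t h h0 h4] at hr
    exact ⟨n, ⟨hn, hr.1⟩, hr.2⟩
  · rintro ⟨n, ⟨hn, hd⟩, h⟩
    exact ⟨oE n, oE_mem hn, (oE_iface Z n ((mem_Ix l n).1 hn).1 t _ h0 h4).2 ⟨hd, h⟩⟩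

lemma hor_fin (Z : ℤ → ℤ → ℝ) (l : ℕ) (t : ℝ) :
    ((fun n => gA Z n + gB Z n * t) '' {n | n ∈ Ix l ∧ oDom n t}).Finite :=
  Set.Finite.image _ ((Ix l).finite_toSet.subset fun _ h => h.1)

lemma hor_ge (Z : ℤ → ℤ → ℝ) (l : ℕ) (t : ℝ) (h0 : 0 < t) (h4 : t < 4) (n : OIdx)
    (hn : n ∈ Ix l) (hd : oDom n t) : gA Z n + gB Z n * t ≤ horizon Z (EE l) t := by
  rw [horizon, hor_set Z l t h0 h4]
  exact le_csSup (hor_fin Z l t).bddAbove ⟨n, ⟨hn, hd⟩, rfl⟩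

lemma hor_att (Z : ℤ → ℤ → ℝ) (l : ℕ) (t : ℝ) (h0 : 0 < t) (h4 : t < 4) (n : OIdx)
    (hn : n ∈ Ix l) (hd : oDom n t) :
    ∃ m ∈ Ix l, oDom m t ∧ gA Z m + gB Z m * t = horizon Z (EE l) t := by
  rw [horizon, hor_set Z l t h0 h4]
  obtain ⟨m, hm, h⟩ := Set.Nonempty.csSup_mem
    (s := (fun n => gA Z n + gB Z n * t) '' {n | n ∈ Ix l ∧ oDom n t})
    ⟨_, n, ⟨hn, hd⟩, rfl⟩ (hor_fin Z l t)
  exact ⟨m, hm.1, hm.2, h⟩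

def att (Z : ℤ → ℤ → ℝ) (l : ℕ) (q : Fin 4) (s : Bool) (i : ℕ) (n : OIdx) : Set ℝ :=
  {w | slA l q s i < w ∧ w < slB l q s i ∧ oDom n w ∧ gA Z n + gB Z n * w = horizon Z (EE l) w}

open Classical in
noncomputable def bdF (l : ℕ) : Finset ℝ :=
  ((Finset.univ : Finset (Fin 4)) ×ˢ (Finset.univ : Finset Bool) ×ˢ Finset.range (l + 1)).image
    (fun p => cen p.1 p.2.1 + sg p.2.1 * tau l p.2.2)

open Classical in
noncomputable def evF (Z : ℤ → ℤ → ℝ) (l : ℕ) : Finset ℝ :=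
  ((Finset.univ : Finset (Fin 4)) ×ˢ (Finset.univ : Finset Bool) ×ˢ Finset.range l ×ˢ
    Finset.Icc 1 l ×ˢ Finset.range 2 ×ˢ (Finset.univ : Finset Bool)).image
    (fun p => if p.2.2.2.2.2 then
      sSup (att Z l p.1 p.2.1 p.2.2.1
        (p.1, p.2.1, p.2.2.2.1, p.2.2.1 * p.2.2.2.1 / l + p.2.2.2.2.1))
      else sInf (att Z l p.1 p.2.1 p.2.2.1
        (p.1, p.2.1, p.2.2.2.1, p.2.2.1 * p.2.2.2.1 / l + p.2.2.2.2.1)))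

open Classical in
lemma F_card (Z : ℤ → ℤ → ℝ) (l : ℕ) (hl : 1 ≤ l) : (bdF l ∪ evF Z l).card ≤ 48 * l ^ 2 := by
  have h1 : (bdF l).card ≤ 8 * (l + 1) := by
    refine le_trans Finset.card_image_le ?_
    simp [Finset.card_product]; omega
  have h2 : (evF Z l).card ≤ 32 * l ^ 2 := by
    refine le_trans Finset.card_image_le ?_
    simp [Finset.card_product]; nlinarith
  refine le_trans (Finset.card_union_le _ _) ?_
  nlinarith

lemma evF_mem (Z : ℤ → ℤ → ℝ) {l : ℕ} (hl : 1 ≤ l) (q : Fin 4) (s : Bool) {i : ℕ} (hi : i < l)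
    (n : OIdx) (hn : n ∈ Ix l) (t : ℝ) (h1 : slA l q s i < t) (h2 : t < slB l q s i)
    (hd : oDom n t) : sSup (att Z l q s i n) ∈ evF Z l ∧ sInf (att Z l q s i n) ∈ evF Z l := by
  obtain ⟨hk, hkl, hj⟩ := (mem_Ix l n).1 hn
  obtain ⟨e1, e2, e3⟩ := slab_inc hl q s hi t h1 h2 n hk hkl hj hd
  obtain ⟨q', s', k, j⟩ := n
  simp only at *
  subst e1 e2
  have : ∃ δ < 2, j = i * k / l + δ := by
    rcases e3 with h | h
    · exact ⟨0, by norm_num, h⟩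
    · exact ⟨1, by norm_num, h⟩
  obtain ⟨δ, hδ, rfl⟩ := this
  constructor
  · refine Finset.mem_image.2 ⟨(q', s', i, k, δ, true), ?_, ?_⟩
    · simp [hi, hk, hkl, hδ]
    · simp
  · refine Finset.mem_image.2 ⟨(q', s', i, k, δ, false), ?_, ?_⟩
    · simp [hi, hk, hkl, hδ]
    · simp

lemma piece_events (Z : ℤ → ℤ → ℝ) {l : ℕ} (hl : 1 ≤ l) (I : Set ℝ)
    (hI : MaxHorizonPiece Z (EE l) I) (hba : BddAbove I) (hbb : BddBelow I)
    (h04 : ∀ t ∈ I, 0 ≤ t ∧ t ≤ 4) :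
    (sSup I ∈ bdF l ∨ sSup I ∈ evF Z l) ∨ sInf I ∈ evF Z l := by
  obtain ⟨⟨hne, hoc, e, he, hIe⟩, hmax⟩ := hI
  obtain ⟨c, hc, hpe⟩ := EE_pts Z he
  rw [hpe] at hIe
  obtain ⟨hck, hckl, hcj⟩ := (mem_Ix l c).1 hc
  have hsup := isLUB_csSup hne hba
  have hinf := isGLB_csInf hne hbb
  obtain ⟨p0, hp0⟩ := hne
  have hsup0 : 0 ≤ sSup I := le_trans (h04 p0 hp0).1 (hsup.1 hp0)
  have hsup4 : sSup I ≤ 4 := hsup.2 fun t ht => (h04 t ht).2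
  rcases slab_cover hl _ hsup0 hsup4 with ⟨q, s, i, hi, h⟩ | ⟨q, s, i, hi, ha, hb⟩
  · left; left
    exact Finset.mem_image.2 ⟨(q, s, i), by simp; omega, h.symm⟩
  have hpos := slab_pos hl q s hi
  have hif : ∀ t, slA l q s i < t → t < slB l q s i →
      ((∃ r ∈ edgePts Z (oE c), azimuth r = t ∧ scrHeight r = horizon Z (EE l) t) ↔
       (oDom c t ∧ gA Z c + gB Z c * t = horizon Z (EE l) t)) := fun t h1 h2 =>
    oE_iface Z c hck t _ (hpos t h1 h2).1 (hpos t h1 h2).2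
  have hIP : ∀ t ∈ I, slA l q s i < t → t < slB l q s i →
      oDom c t ∧ gA Z c + gB Z c * t = horizon Z (EE l) t := fun t ht h1 h2 =>
    (hif t h1 h2).1 (hIe t ht)
  have H1 : ∀ t, slA l q s i < t → t < slB l q s i → ∀ n ∈ Ix l, oDom n t →
      gA Z n + gB Z n * t ≤ horizon Z (EE l) t := fun t h1 h2 n hn hd =>
    hor_ge Z l t (hpos t h1 h2).1 (hpos t h1 h2).2 n hn hd
  have H2 : ∀ t, slA l q s i < t → t < slB l q s i → ∀ n ∈ Ix l, oDom n t →
      ∃ m ∈ Ix l, oDom m t ∧ gA Z m + gB Z m * t = horizon Z (EE l) t := fun t h1 h2 n hn hd =>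
    hor_att Z l t (hpos t h1 h2).1 (hpos t h1 h2).2 n hn hd
  have H3 : ∀ n ∈ Ix l,
      (∀ t u, slA l q s i < u → u ≤ t → t < slB l q s i → oDom n t → oDom n u) ∨
      (∀ t u, slA l q s i < t → t ≤ u → u < slB l q s i → oDom n t → oDom n u) := fun n hn =>
    slab_LR hl q s hi n ((mem_Ix l n).1 hn).1 ((mem_Ix l n).1 hn).2.1 ((mem_Ix l n).1 hn).2.2
  obtain ⟨p, hpI, hap⟩ := (lt_isLUB_iff hsup).1 ha
  have hps := hsup.1 hpI
  have hpb : p < slB l q s i := lt_of_le_of_lt hps hb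
  have hPp := hIP p hpI hap hpb
  by_cases hL : ∀ t u, slA l q s i < u → u ≤ t → t < slB l q s i → oDom c t → oDom c u
  · left; right
    rcases slab_left (Ix l) oDom (gA Z) (gB Z) (horizon Z (EE l)) _ _ H1 H2 H3 c hc hL I (sSup I)
      hsup ha hb hIP with h | ⟨e', he', ⟨u, hu1, hu2, hu3⟩, hg⟩ | ⟨γ, hγ, hγb, h⟩
    · have : IsLUB (att Z l q s i c) (sSup I) := by
        constructor
        · rintro w ⟨h1, h2, h3, h4⟩
          exact h w h1 h2 h3 h4
        · intro m hm
          by_contra hlt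
          push Not at hlt
          obtain ⟨x, hx, hx'⟩ := (lt_isLUB_iff hsup).1 (max_lt ha hlt)
          have hx1 := lt_of_le_of_lt (le_max_left _ _) hx'
          have hx2 := lt_of_le_of_lt (le_max_right _ _) hx'
          have hx3 := lt_of_le_of_lt (hsup.1 hx) hb
          have := hIP x hx hx1 hx3
          exact absurd (hm ⟨hx1, hx3, this.1, this.2⟩) (not_le.2 hx2)
      rw [← this.csSup_eq ⟨p, hap, hpb, hPp.1, hPp.2⟩]
      exact (evF_mem Z hl q s hi c hc p hap hpb hPp.1).1
    · have hne' : (att Z l q s i e').Nonempty := by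
        by_contra hemp
        rw [Set.not_nonempty_iff_eq_empty] at hemp
        have hg' : IsGLB (att Z l q s i e') (sSup I) := hg
        rw [hemp] at hg'
        have := hg'.2 (show sSup I + 1 ∈ lowerBounds ∅ by simp)
        linarith
      have hg' : IsGLB (att Z l q s i e') (sSup I) := hg
      rw [← hg'.csInf_eq hne']
      exact (evF_mem Z hl q s hi e' he' u hu1 hu2 hu3).2
    · exfalso
      have hJ : HorizonPiece Z (EE l) (I ∪ Set.Ico (sSup I) γ) := by
        refine ⟨⟨p, Or.inl hpI⟩, ⟨?_⟩, oE c, oE_mem hc, ?_⟩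
        · rintro x hx y hy z ⟨hz1, hz2⟩
          rcases lt_or_ge z (sSup I) with hz | hz
          · left
            rcases hx with hx | hx
            · obtain ⟨v, hv, hzv⟩ := (lt_isLUB_iff hsup).1 hz
              exact hoc.out hx hv ⟨hz1, hzv.le⟩
            · exact absurd (le_trans hx.1 hz1) (not_le.2 hz)
          · right
            refine ⟨hz, ?_⟩
            rcases hy with hy | hy
            · exact lt_of_le_of_lt (le_trans hz2 (hsup.1 hy)) hγ
            · exact lt_of_le_of_lt hz2 hy.2
        · rintro t (ht | ht)
          · exact hIe t ht
          · exact (hif t (lt_of_lt_of_le ha ht.1) (ht.2.trans hγb)).2 (h t ht.1 ht.2)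
      have heq := hmax _ hJ Set.subset_union_left
      obtain ⟨x, hx1, hx2⟩ := exists_between hγ
      have hxI : x ∈ I := by rw [← heq]; exact Or.inr ⟨hx1.le, hx2⟩
      exact absurd (hsup.1 hxI) (not_le.2 hx1)
  · right
    have hR := (H3 c hc).resolve_left hL
    push Not at hL
    obtain ⟨t0, u0, hu0, hut0, ht0, hdt0, hdu0⟩ := hL
    have hlow : ∀ x ∈ I, u0 ≤ x := by
      intro x hx
      by_contra hlt
      push Not at hlt
      -- the point u0 is not covered by c, so the interval I lies above it
      have hnot : ∀ y, slA l q s i < y → y ≤ u0 → ¬ oDom c y := fun y h1 h2 h3 =>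
        hdu0 (hR y u0 h1 h2 (lt_of_le_of_lt hut0 ht0) h3)
      rcases lt_or_ge (slA l q s i) x with h | h
      · exact hnot x h hlt.le (hIP x hx h (by linarith)).1
      · have hpu : u0 < p := by
          by_contra h5
          push Not at h5
          exact hnot p hap h5 hPp.1
        exact hdu0 (hIP u0 (hoc.out hx hpI ⟨hlt.le, hpu.le⟩) hu0 (by linarith)).1
    have hia : slA l q s i < sInf I := lt_of_lt_of_le hu0 (hinf.2 hlow)
    have hib : sInf I < slB l q s i := lt_of_le_of_lt (hinf.1 hpI) hpb
    rcases slab_right (Ix l) oDom (gA Z) (gB Z) (horizon Z (EE l)) _ _ H1 H2 H3 c hc hR I (sInf I)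
      hinf hia hib hIP with h | ⟨e', he', ⟨u, hu1, hu2, hu3⟩, hg⟩ | ⟨γ, hγ, hγb, h⟩
    · have : IsGLB (att Z l q s i c) (sInf I) := by
        constructor
        · rintro w ⟨h1, h2, h3, h4⟩
          exact h w h1 h2 h3 h4
        · intro m hm
          by_contra hlt
          push Not at hlt
          obtain ⟨x, hx, hx'⟩ := (isGLB_lt_iff hinf).1 (lt_min hib hlt)
          have hx1 := lt_of_lt_of_le hx' (min_le_left _ _)
          have hx2 := lt_of_lt_of_le hx' (min_le_right _ _)
          have hx3 := lt_of_lt_of_le hia (hinf.1 hx)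
          have := hIP x hx hx3 hx1
          exact absurd (hm ⟨hx3, hx1, this.1, this.2⟩) (not_le.2 hx2)
      rw [← this.csInf_eq ⟨p, hap, hpb, hPp.1, hPp.2⟩]
      exact (evF_mem Z hl q s hi c hc p hap hpb hPp.1).2
    · have hg' : IsLUB (att Z l q s i e') (sInf I) := hg
      have hne' : (att Z l q s i e').Nonempty := by
        by_contra hemp
        rw [Set.not_nonempty_iff_eq_empty] at hemp
        rw [hemp] at hg'
        have := hg'.2 (show sInf I - 1 ∈ upperBounds ∅ by simp)
        linarith
      rw [← hg'.csSup_eq hne']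
      exact (evF_mem Z hl q s hi e' he' u hu1 hu2 hu3).1
    · exfalso
      have hJ : HorizonPiece Z (EE l) (I ∪ Set.Ioc γ (sInf I)) := by
        refine ⟨⟨p, Or.inl hpI⟩, ⟨?_⟩, oE c, oE_mem hc, ?_⟩
        · rintro x hx y hy z ⟨hz1, hz2⟩
          rcases lt_or_ge (sInf I) z with hz | hz
          · left
            rcases hy with hy | hy
            · obtain ⟨v, hv, hzv⟩ := (isGLB_lt_iff hinf).1 hz
              exact hoc.out hv hy ⟨hzv.le, hz2⟩
            · exact absurd (le_trans hz2 hy.2) (not_le.2 hz)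
          · right
            refine ⟨?_, hz⟩
            rcases hx with hx | hx
            · exact lt_of_lt_of_le hγ (le_trans (hinf.1 hx) hz1)
            · exact lt_of_lt_of_le hx.1 hz1
        · rintro t (ht | ht)
          · exact hIe t ht
          · exact (hif t (hγb.trans ht.1) (lt_of_le_of_lt ht.2 hib)).2 (h t ht.2 ht.1)
      have heq := hmax _ hJ Set.subset_union_left
      obtain ⟨x, hx1, hx2⟩ := exists_between hγ
      have hxI : x ∈ I := by rw [← heq]; exact Or.inr ⟨hx1, hx2.le⟩
      exact absurd (hinf.1 hxI) (not_le.2 hx2)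

/-- The horizon of the set of all edges of layers `1` through `l` in a square
region of `l` layers around the viewpoint has complexity `O(l²)`. -/
theorem horizon_l_layers_quadratic :
    ∃ C : ℕ, 0 < C ∧ ∀ l : ℕ, 1 ≤ l → ∀ Z : ℤ → ℤ → ℝ,
      {I : Set ℝ | MaxHorizonPiece Z
          {e | ∃ k : ℕ, 1 ≤ k ∧ k ≤ l ∧ IsLayerEdge k e} I}.Finite ∧
      {I : Set ℝ | MaxHorizonPiece Z
          {e | ∃ k : ℕ, 1 ≤ k ∧ k ≤ l ∧ IsLayerEdge k e} I}.ncard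
        ≤ C * l ^ 2 := by
  classical
  refine ⟨192, by norm_num, fun l hl Z => ?_⟩
  have h04 : ∀ I, MaxHorizonPiece Z (EE l) I → ∀ t ∈ I, 0 ≤ t ∧ t ≤ 4 := by
    intro I hI t ht
    obtain ⟨⟨-, -, e, -, h⟩, -⟩ := hI
    obtain ⟨r, -, hr, -⟩ := h t ht
    rw [← hr]
    exact azimuth_mem r
  have hb : ∀ I, MaxHorizonPiece Z (EE l) I → BddAbove I ∧ BddBelow I := fun I hI =>
    ⟨⟨4, fun t ht => (h04 I hI t ht).2⟩, ⟨0, fun t ht => (h04 I hI t ht).1⟩⟩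
  have := antichain_count (M := MaxHorizonPiece Z (EE l)) (fun I hI => hI.1.2.1)
    (fun I hI => hI.1.1) hb (fun I J hI hJ h => hI.2 J hJ.1 h) (bdF l ∪ evF Z l)
    (fun I hI => by
      have := piece_events Z hl I hI (hb I hI).1 (hb I hI).2 (h04 I hI)
      simp only [Finset.mem_union]
      tauto)
  refine ⟨this.1, le_trans this.2 ?_⟩
  have := F_card Z l hl
  omega
end

section
/- There is an absolute constant C such that for every integer m ≥ 1 and every assignment of real elevations to the grid points of a (2m+1) × (2m+1) grid centered at the viewpoint, the horizon of the set of all layer edges of the grid (layers 1 through m) has complexity at most C·n, where n = (2m+1)² is the number of grid points. In other words, the horizon of a grid of n points with linear interpolation along layers has complexity O(n) in the worst case. -/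
namespace HG
open Filter Topology

lemma card_of_rel {ι : Type*} (S : Finset ι) (D : Set ℝ) (R : ι → ℝ → Prop)
    (h : ∀ t ∈ D, ∃ i ∈ S, R i t)
    (hu : ∀ i t t', t ∈ D → t' ∈ D → t < t' → R i t → R i t' → False) :
    ∃ Q : Finset ℝ, (∀ t ∈ D, t ∈ Q) ∧ Q.card ≤ S.card := by
  classical
  choose f hf hR using h
  have hfin : D.Finite := by
    have : Finite D := by
      apply Finite.of_injective (β := S) (fun t => ⟨f t.1 t.2, hf _ _⟩)
      intro x y hxy
      have hxy' : f x.1 x.2 = f y.1 y.2 := by simpa using hxy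
      rcases lt_trichotomy x.1 y.1 with h1 | h1 | h1
      · exact (hu _ _ _ x.2 y.2 h1 (hR x.1 x.2) (hxy' ▸ hR y.1 y.2)).elim
      · exact Subtype.ext h1
      · exact (hu _ _ _ y.2 x.2 h1 (hR y.1 y.2) (hxy' ▸ hR x.1 x.2)).elim
    exact D.toFinite
  refine ⟨hfin.toFinset, by simp, ?_⟩
  rw [← Finset.card_attach]
  apply Finset.card_le_card_of_injOn (fun t => f t.1 (hfin.mem_toFinset.1 t.2))
  · intro t _
    exact hf _ _
  · intro x _ y _ hxy
    have hx := hfin.mem_toFinset.1 x.2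
    have hy := hfin.mem_toFinset.1 y.2
    have hxy' : f x.1 hx = f y.1 hy := hxy
    rcases lt_trichotomy x.1 y.1 with h1 | h1 | h1
    · exact (hu _ _ _ hx hy h1 (hR x.1 hx) (hxy' ▸ hR y.1 hy)).elim
    · exact Subtype.ext h1
    · exact (hu _ _ _ hy hx h1 (hR y.1 hy) (hxy' ▸ hR x.1 hx)).elim

/-- active -/
def Act {ι : Type*} (p : ι → Bool) (b : ι → ℝ) (i : ι) (t : ℝ) : Prop :=
  if p i = true then t ≤ b i else b i ≤ t

def TC {ι : Type*} (S : Finset ι) (p : ι → Bool) (b c d : ι → ℝ) (q : Bool) (i : ι) (t : ℝ) : Prop :=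
  i ∈ S ∧ p i = q ∧ Act p b i t ∧
    ∀ j ∈ S, p j = q → Act p b j t → c j + d j * t ≤ c i + d i * t

def Con {ι : Type*} (S : Finset ι) (p : ι → Bool) (b c d : ι → ℝ) (i : ι) (t : ℝ) : Prop :=
  i ∈ S ∧ Act p b i t ∧
    ∀ j ∈ S, Act p b j t → c j + d j * t ≤ c i + d i * t

section
variable {ι : Type*} {S : Finset ι} {p : ι → Bool} {b c d : ι → ℝ}

lemma Con.tc {i : ι} {t : ℝ} (h : Con S p b c d i t) : TC S p b c d (p i) i t :=
  ⟨h.1, rfl, h.2.1, fun j hj _ ha => h.2.2 j hj ha⟩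

lemma act_ev {i : ι} {t : ℝ} (hb : t ≠ b i) (h : Act p b i t) : ∀ᶠ s in 𝓝 t, Act p b i s := by
  unfold Act at *
  split_ifs at h ⊢ with hp
  · exact (eventually_lt_nhds (lt_of_le_of_ne h hb)).mono fun s hs => hs.le
  · exact (eventually_gt_nhds (lt_of_le_of_ne h hb.symm)).mono fun s hs => hs.le

lemma nact_ev {i : ι} {t : ℝ} (h : ¬ Act p b i t) : ∀ᶠ s in 𝓝 t, ¬ Act p b i s := by
  unfold Act at *
  split_ifs at h ⊢ with hp
  · exact (eventually_gt_nhds (not_le.1 h)).mono fun s hs => not_le.2 hs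
  · exact (eventually_lt_nhds (not_le.1 h)).mono fun s hs => not_le.2 hs

lemma lin_ev {i j : ι} {t : ℝ} (h : c j + d j * t < c i + d i * t) :
    ∀ᶠ s in 𝓝 t, c j + d j * s < c i + d i * s := by
  have h1 : Continuous fun s : ℝ => c j + d j * s := by fun_prop
  have h2 : Continuous fun s : ℝ => c i + d i * s := by fun_prop
  exact h1.continuousAt.eventually_lt h2.continuousAt h

lemma con_of_freq {i : ι} {t : ℝ} (hb : ∀ j ∈ S, t ≠ b j)
    (h : ∃ᶠ s in 𝓝 t, Con S p b c d i s) : Con S p b c d i t := by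
  have hi : i ∈ S := by
    obtain ⟨s, hs⟩ := h.exists
    exact hs.1
  refine ⟨hi, ?_, ?_⟩
  · by_contra hn
    exact h ((nact_ev hn).mono fun s hs hc => hs hc.2.1)
  · intro j hj ha
    by_contra hn
    exact h (((act_ev (hb j hj) ha).and (lin_ev (not_le.1 hn))).mono
      fun s hs hc => absurd (hc.2.2 j hj hs.1) (not_le.2 hs.2))

lemma con_stable {i : ι} {t : ℝ} (hb : ∀ j ∈ S, t ≠ b j)
    (h : Con S p b c d i t)
    (hd : ∀ j, Con S p b c d j t → d j = d i) : ∀ᶠ s in 𝓝 t, Con S p b c d i s := by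
  have key : ∀ j ∈ S, ∀ᶠ s in 𝓝 t, Act p b j s → c j + d j * s ≤ c i + d i * s := by
    intro j hj
    by_cases ha : Act p b j t
    · rcases lt_or_eq_of_le (h.2.2 j hj ha) with h1 | h1
      · exact (lin_ev h1).mono fun s hs _ => hs.le
      · have hcj : Con S p b c d j t := ⟨hj, ha, fun k hk hak => h1 ▸ h.2.2 k hk hak⟩
        have hdj := hd j hcj
        refine Eventually.of_forall fun s _ => ?_
        rw [hdj] at h1 ⊢
        linarith
    · exact (nact_ev ha).mono fun s hs hs' => (hs hs').elim
  have := (Finset.eventually_all S).2 key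
  filter_upwards [this, act_ev (hb i h.1) h.2.1] with s h1 h2
  exact ⟨h.1, h2, fun j hj => h1 j hj⟩

lemma act_const {i : ι} {t t' s : ℝ} (hb : ∀ x, t ≤ x → x ≤ t' → x ≠ b i) (h1 : t ≤ s) (h2 : s ≤ t')
    {s' : ℝ} (h3 : t ≤ s') (h4 : s' ≤ t') (h : Act p b i s) : Act p b i s' := by
  unfold Act at *
  by_contra hn
  split_ifs at h hn with hp
  · push Not at hn
    exact hb (b i) (h1.trans h) (hn.le.trans h4) rfl
  · push Not at hn
    exact hb (b i) (h3.trans hn.le) (h.trans h2) rfl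

lemma persist {q : Bool} {i : ι} {t t' : ℝ} (htt : t ≤ t')
    (hb : ∀ j ∈ S, ∀ x, t ≤ x → x ≤ t' → x ≠ b j)
    (hD : ∀ x, t ≤ x → x ≤ t' → ∀ j k, TC S p b c d q j x → TC S p b c d q k x → ¬ d j < d k)
    (h : TC S p b c d q i t) : TC S p b c d q i t' := by
  classical
  obtain ⟨hi, hq, ha, hm⟩ := h
  refine ⟨hi, hq, act_const (hb i hi) le_rfl htt htt le_rfl ha, ?_⟩
  by_contra hcon
  push Not at hcon
  obtain ⟨k0, hk0, hk0q, hk0a, hk0l⟩ := hcon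
  set K := S.filter (fun k => p k = q ∧ Act p b k t' ∧ c i + d i * t' < c k + d k * t') with hK
  have hKne : K.Nonempty := ⟨k0, by simp [hK, hk0, hk0q, hk0a, hk0l]⟩
  obtain ⟨k, hk, hmin⟩ := Finset.exists_min_image K (fun k => (c i - c k) / (d k - d i)) hKne
  have hprop : ∀ k ∈ K, d i < d k ∧ t ≤ (c i - c k) / (d k - d i) ∧ (c i - c k) / (d k - d i) < t' := by
    intro k hk
    simp only [hK, Finset.mem_filter] at hk
    obtain ⟨hkS, hkq, hka, hkl⟩ := hk
    have h1 := hm k hkS hkq (act_const (hb k hkS) htt le_rfl le_rfl htt hka)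
    have hd : d i < d k := by
      by_contra hn
      nlinarith [mul_nonneg (sub_nonneg.2 htt) (sub_nonneg.2 (not_lt.1 hn))]
    have hpos : 0 < d k - d i := by linarith
    refine ⟨hd, ?_, ?_⟩
    · rw [le_div_iff₀ hpos]; linarith
    · rw [div_lt_iff₀ hpos]; linarith
  obtain ⟨hd, hx1, hx2⟩ := hprop k hk
  set x := (c i - c k) / (d k - d i) with hx
  have hpos : 0 < d k - d i := by linarith
  have heq : c i + d i * x = c k + d k * x := by
    have : x * (d k - d i) = c i - c k := by rw [hx]; field_simp
    linarith
  have hk' := hk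
  simp only [hK, Finset.mem_filter] at hk'
  have hci : TC S p b c d q i x := by
    refine ⟨hi, hq, act_const (hb i hi) le_rfl htt hx1 hx2.le ha, ?_⟩
    intro j hj hjq hja
    have hjt := act_const (hb j hj) hx1 hx2.le le_rfl htt hja
    have hjt' := act_const (hb j hj) hx1 hx2.le htt le_rfl hja
    have h1 := hm j hj hjq hjt
    by_cases hl : c i + d i * t' < c j + d j * t'
    · have hjK : j ∈ K := by simp [hK, hj, hjq, hjt', hl]
      have h2 := hmin j hjK
      obtain ⟨hdj, _, _⟩ := hprop j hjK
      have hposj : 0 < d j - d i := by linarith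
      have h2' : x ≤ (c i - c j) / (d j - d i) := h2
      rw [le_div_iff₀ hposj] at h2'
      linarith
    · push Not at hl
      by_cases hdd : d i ≤ d j
      · nlinarith [mul_nonneg (sub_nonneg.2 hdd) (sub_nonneg.2 hx2.le)]
      · nlinarith [mul_nonneg (sub_nonneg.2 (not_le.1 hdd).le) (sub_nonneg.2 hx1)]
  have hck : TC S p b c d q k x :=
    ⟨hk'.1, hk'.2.1, act_const (hb k hk'.1) htt le_rfl hx1 hx2.le hk'.2.2.1,
      fun j hj hjq hja => heq ▸ hci.2.2.2 j hj hjq hja⟩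
  exact hD x hx1 hx2.le i k hci hck hd

lemma tc_eq {q : Bool} {i j : ι} {t : ℝ} (hi : TC S p b c d q i t) (hj : TC S p b c d q j t) :
    c i + d i * t = c j + d j * t :=
  le_antisymm (hj.2.2.2 i hi.1 hi.2.1 hi.2.2.1) (hi.2.2.2 j hj.1 hj.2.1 hj.2.2.1)

variable (S p b c d)

lemma double_card (q : Bool) : ∃ Q : Finset ℝ, Q.card ≤ S.card ∧
    ∀ t j k, TC S p b c d q j t → TC S p b c d q k t → d j < d k → t ∈ Q := by
  have : ∃ Q : Finset ℝ, (∀ t ∈ {t : ℝ | ∃ j k, TC S p b c d q j t ∧ TC S p b c d q k t ∧ d j < d k}, t ∈ Q)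
      ∧ Q.card ≤ S.card := by
    cases q with
    | true =>
      apply card_of_rel S _ (fun k t => TC S p b c d true k t ∧ ∃ j, TC S p b c d true j t ∧ d j < d k)
      · rintro t ⟨j, k, hj, hk, hd⟩
        exact ⟨k, hk.1, hk, j, hj, hd⟩
      · rintro k t t' - - htt ⟨hk, -⟩ ⟨hk', j, hj, hd⟩
        have e := tc_eq hj hk'
        have ha : Act p b j t := by
          have := hj.2.2.1
          unfold Act at *
          rw [if_pos hj.2.1] at *
          linarith
        have := hk.2.2.2 j hj.1 hj.2.1 ha
        nlinarith [mul_pos (sub_pos.2 htt) (sub_pos.2 hd)]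
    | false =>
      apply card_of_rel S _ (fun k t => TC S p b c d false k t ∧ ∃ j, TC S p b c d false j t ∧ d k < d j)
      · rintro t ⟨j, k, hj, hk, hd⟩
        exact ⟨j, hj.1, hj, k, hk, hd⟩
      · rintro k t t' - - htt ⟨hk, j, hj, hd⟩ ⟨hk', -⟩
        have e := tc_eq hj hk
        have ha : Act p b j t' := by
          have := hj.2.2.1
          unfold Act at *
          rw [if_neg (by simp [hj.2.1])] at *
          linarith
        have := hk'.2.2.2 j hj.1 hj.2.1 ha
        nlinarith [mul_pos (sub_pos.2 htt) (sub_pos.2 hd)]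
  obtain ⟨Q, h1, h2⟩ := this
  exact ⟨Q, h2, fun t j k hj hk hd => h1 t ⟨j, k, hj, hk, hd⟩⟩

lemma card_of_sep (Q : Finset ℝ) (D : Set ℝ)
    (h : ∀ t ∈ D, ∀ t' ∈ D, t < t' → ∃ x ∈ Q, t < x ∧ x < t') :
    ∃ R : Finset ℝ, (∀ t ∈ D, t ∈ R) ∧ R.card ≤ Q.card + 1 := by
  classical
  obtain ⟨R, h1, h2⟩ := card_of_rel (insert (⊥ : WithBot ℝ) (Q.image (fun x : ℝ => (x : WithBot ℝ)))) D
    (fun o t => o < (t : WithBot ℝ) ∧ ∀ x ∈ Q, x < t → (x : WithBot ℝ) ≤ o) (by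
      intro t ht
      by_cases hne : (Q.filter (· < t)).Nonempty
      · refine ⟨((Q.filter (· < t)).max' hne : ℝ), ?_, ?_, ?_⟩
        · have := Finset.max'_mem _ hne
          simp only [Finset.mem_filter] at this
          simp only [Finset.mem_insert, Finset.mem_image]
          exact Or.inr ⟨_, this.1, rfl⟩
        · have := Finset.max'_mem _ hne
          simp only [Finset.mem_filter] at this
          exact_mod_cast this.2
        · intro x hx hxt
          exact_mod_cast Finset.le_max' _ x (by simp [hx, hxt])
      · refine ⟨⊥, by simp, WithBot.bot_lt_coe t, ?_⟩
        intro x hx hxt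
        exact (hne ⟨x, by simp [hx, hxt]⟩).elim) (by
      rintro o t t' ht ht' htt ⟨h1, -⟩ ⟨-, h2⟩
      obtain ⟨x, hx, hx1, hx2⟩ := h t ht t' ht' htt
      have := lt_of_le_of_lt (h2 x hx hx2) h1
      have : x < t := by exact_mod_cast this
      linarith)
  refine ⟨R, h1, h2.trans ((Finset.card_insert_le _ _).trans ?_)⟩
  gcongr
  exact Finset.card_image_le

theorem slab : ∃ Q : Finset ℝ, Q.card ≤ 6 * S.card + 1 ∧
    ∀ t ∉ Q, ∀ i, (∃ᶠ s in 𝓝 t, Con S p b c d i s) → ∀ᶠ s in 𝓝 t, Con S p b c d i s := by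
  classical
  obtain ⟨QL, hL, hL'⟩ := double_card S p b c d true
  obtain ⟨QR, hR, hR'⟩ := double_card S p b c d false
  set Q' := S.image b ∪ (QL ∪ QR) with hQ'
  have hQ'c : Q'.card ≤ 3 * S.card := by
    rw [hQ']
    have := Finset.card_union_le (S.image b) (QL ∪ QR)
    have := Finset.card_union_le QL QR
    have := Finset.card_image_le (s := S) (f := b)
    omega
  obtain ⟨QM, hM, hMc⟩ := card_of_sep Q'
    {t | t ∉ Q' ∧ ∃ i j, TC S p b c d true i t ∧ TC S p b c d false j t ∧
      c i + d i * t = c j + d j * t ∧ d i ≠ d j} (by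
    rintro t ⟨htQ, i, j, hi, hj, he, hd⟩ t' ⟨htQ', i', j', hi', hj', he', hd'⟩ htt
    by_contra hcon
    push Not at hcon
    have hav : ∀ x, t ≤ x → x ≤ t' → x ∉ Q' := by
      intro x h1 h2 hx
      rcases eq_or_lt_of_le h1 with h1 | h1
      · exact htQ (h1 ▸ hx)
      rcases eq_or_lt_of_le h2 with h2 | h2
      · exact htQ' (h2 ▸ hx)
      exact absurd h2 (not_lt.2 (hcon x hx h1))
    have hb : ∀ j ∈ S, ∀ x, t ≤ x → x ≤ t' → x ≠ b j := by
      intro j hj x h1 h2 hx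
      apply hav x h1 h2
      rw [hQ', Finset.mem_union, Finset.mem_image]
      exact Or.inl ⟨j, hj, hx.symm⟩
    have pi := persist htt.le hb (fun x h1 h2 j k hj hk hd => hav x h1 h2 (by
      simp only [hQ', Finset.mem_union]; exact Or.inr (Or.inl (hL' x j k hj hk hd)))) hi
    have pj := persist htt.le hb (fun x h1 h2 j k hj hk hd => hav x h1 h2 (by
      simp only [hQ', Finset.mem_union]; exact Or.inr (Or.inr (hR' x j k hj hk hd)))) hj
    have e1 := tc_eq pi hi'
    have e2 := tc_eq pj hj'
    have : (d i - d j) * (t' - t) = 0 := by linarith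
    rcases mul_eq_zero.1 this with h | h
    · exact hd (by linarith)
    · linarith)
  refine ⟨Q' ∪ QM, ?_, ?_⟩
  · have := Finset.card_union_le Q' QM
    omega
  · intro t ht i hf
    simp only [hQ', Finset.mem_union, not_or, Finset.mem_image, not_exists, not_and] at ht
    obtain ⟨⟨hb, hnL, hnR⟩, hnM⟩ := ht
    have hb' : ∀ j ∈ S, t ≠ b j := fun j hj h => hb j hj h.symm
    have hi := con_of_freq hb' hf
    apply con_stable hb' hi
    have hQt : t ∉ Q' := by
      simp only [hQ', Finset.mem_union, not_or, Finset.mem_image, not_exists, not_and]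
      exact ⟨hb, hnL, hnR⟩
    have hsame : ∀ j k, Con S p b c d j t → Con S p b c d k t → ¬ d j < d k := by
      intro j k hj hk hd
      have he : c j + d j * t = c k + d k * t :=
        le_antisymm (hk.2.2 j hj.1 hj.2.1) (hj.2.2 k hk.1 hk.2.1)
      have tj := hj.tc
      have tk := hk.tc
      cases hpj : p j <;> cases hpk : p k <;> rw [hpj] at tj <;> rw [hpk] at tk
      · exact hnR (hR' t j k tj tk hd)
      · exact hnM (hM t ⟨hQt, k, j, tk, tj, he.symm, hd.ne'⟩)
      · exact hnM (hM t ⟨hQt, j, k, tj, tk, he, hd.ne⟩)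
      · exact hnL (hL' t j k tj tk hd)
    intro j hj
    exact le_antisymm (not_lt.1 (hsame i j hi hj)) (not_lt.1 (hsame j i hj hi))
end


def SAct (m l k : ℤ) (s : ℝ) : Prop :=
  1 ≤ l ∧ l ≤ m ∧ -l ≤ k ∧ k < l ∧ (k : ℝ) ≤ l * s ∧ l * s ≤ k + 1

noncomputable def gI (V : ℤ → ℤ → ℝ) (x : ℤ × ℤ) : ℝ :=
  ((x.2 + 1) * V x.1 x.2 - x.2 * V x.1 (x.2 + 1)) / x.1

def gS (V : ℤ → ℤ → ℝ) (x : ℤ × ℤ) : ℝ := V x.1 (x.2 + 1) - V x.1 x.2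

def SCon (m : ℤ) (V : ℤ → ℤ → ℝ) (l k : ℤ) (s : ℝ) : Prop :=
  SAct m l k s ∧ ∀ l' k', SAct m l' k' s →
    gI V (l', k') + gS V (l', k') * s ≤ gI V (l, k) + gS V (l, k) * s

noncomputable def slabS (m j : ℤ) : Finset (ℤ × ℤ) :=
  ((Finset.Icc 1 m ×ˢ ({0, 1} : Finset ℤ)).image (fun x => (x.1, x.1 * j / m + x.2))).filter
    (fun x => -x.1 ≤ x.2 ∧ x.2 < x.1)

def slabP (m j : ℤ) (x : ℤ × ℤ) : Bool := decide (x.2 * m ≤ j * x.1)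

noncomputable def slabB (m j : ℤ) (x : ℤ × ℤ) : ℝ :=
  if slabP m j x = true then ((x.2 : ℝ) + 1) / x.1 else (x.2 : ℝ) / x.1

lemma slabS_card (m : ℕ) (j : ℤ) : (slabS m j).card ≤ 2 * m := by
  unfold slabS
  refine (Finset.card_filter_le _ _).trans (Finset.card_image_le.trans ?_)
  simp [Finset.card_product]
  omega

lemma sact_iff {m : ℤ} (hm : 1 ≤ m) {j : ℤ} {s : ℝ} (h1 : (j : ℝ) < m * s) (h2 : m * s < j + 1) (l k : ℤ) :
    SAct m l k s ↔ (l, k) ∈ slabS m j ∧ Act (slabP m j) (slabB m j) (l, k) s := by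
  have hm0 : (0 : ℝ) < m := by exact_mod_cast (by omega : (0 : ℤ) < m)
  constructor
  · rintro ⟨hl1, hlm, hk1, hk2, ha, hb⟩
    have hl0 : (0 : ℝ) < l := by exact_mod_cast (by omega : (0 : ℤ) < l)
    have i1 : k * m < l * (j + 1) := by
      have : (k : ℝ) * m < l * (j + 1) := by nlinarith
      exact_mod_cast this
    have i2 : l * j < m * (k + 1) := by
      have : (l : ℝ) * j < m * (k + 1) := by nlinarith
      exact_mod_cast this
    refine ⟨?_, ?_⟩
    · unfold slabS
      simp only [Finset.mem_filter, Finset.mem_image, Finset.mem_product, Finset.mem_Icc,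
        Finset.mem_insert, Finset.mem_singleton]
      refine ⟨⟨(l, k - l * j / m), ⟨⟨hl1, hlm⟩, ?_⟩, ?_⟩, hk1, hk2⟩
      · have e1 : l * j / m < k + 1 := Int.ediv_lt_of_lt_mul (by omega) (by linarith)
        have e2 : k - 1 ≤ l * j / m := by
          rw [Int.le_ediv_iff_mul_le (by omega)]
          nlinarith
        simp only
        omega
      · simp
    · unfold Act slabB
      split_ifs with hp
      · rw [le_div_iff₀ hl0]; simp only; linarith
      · rw [div_le_iff₀ hl0]; simp only; linarith
  · rintro ⟨hS, hA⟩
    unfold slabS at hS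
    simp only [Finset.mem_filter, Finset.mem_image, Finset.mem_product, Finset.mem_Icc] at hS
    obtain ⟨⟨⟨l', e⟩, ⟨⟨hl1, hlm⟩, -⟩, he⟩, hk1, hk2⟩ := hS
    simp only [Prod.mk.injEq] at he hl1 hlm
    obtain ⟨rfl, -⟩ := he
    have hl0 : (0 : ℝ) < l' := by exact_mod_cast (by omega : (0 : ℤ) < l')
    refine ⟨hl1, hlm, hk1, hk2, ?_⟩
    unfold Act slabB at hA
    split_ifs at hA with hp
    · rw [le_div_iff₀ hl0] at hA
      simp only [slabP, decide_eq_true_eq] at hp hA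
      have hp' : (k : ℝ) * m ≤ j * l' := by exact_mod_cast hp
      refine ⟨?_, by linarith⟩
      have : (k : ℝ) * m ≤ (l' * s) * m := by nlinarith
      exact le_of_mul_le_mul_right this hm0
    · rw [div_le_iff₀ hl0] at hA
      simp only [slabP, decide_eq_true_eq, not_le] at hp hA
      have hp' : (j : ℝ) * l' + 1 ≤ k * m := by exact_mod_cast hp
      have hlm' : (l' : ℝ) ≤ m := by exact_mod_cast hlm
      refine ⟨by linarith, ?_⟩
      have : (l' * s) * m ≤ ((k : ℝ) + 1) * m := by nlinarith
      exact le_of_mul_le_mul_right this hm0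

lemma scon_iff {m : ℤ} (hm : 1 ≤ m) {V : ℤ → ℤ → ℝ} {j : ℤ} {s : ℝ} (h1 : (j : ℝ) < m * s) (h2 : m * s < j + 1) (l k : ℤ) :
    SCon m V l k s ↔ Con (slabS m j) (slabP m j) (slabB m j) (gI V) (gS V) (l, k) s := by
  unfold SCon Con
  rw [← and_assoc, sact_iff hm h1 h2]
  refine and_congr_right fun _ => ?_
  constructor
  · rintro h ⟨l', k'⟩ h1' h2'
    exact h l' k' ((sact_iff hm h1 h2 l' k').2 ⟨h1', h2'⟩)
  · intro h l' k' h'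
    obtain ⟨a, b⟩ := (sact_iff hm h1 h2 l' k').1 h'
    exact h _ a b

theorem side (m : ℕ) (hm : 1 ≤ m) (V : ℤ → ℤ → ℝ) :
    ∃ Q : Finset ℝ, Q.card ≤ 6 * (2 * m + 1) ^ 2 ∧ (1 : ℝ) ∈ Q ∧ (-1 : ℝ) ∈ Q ∧
      ∀ s ∉ Q, |s| < 1 → ∀ l k, (∃ᶠ x in 𝓝 s, SCon m V l k x) → ∀ᶠ x in 𝓝 s, SCon m V l k x := by
  classical
  have hmz : (1 : ℤ) ≤ m := by exact_mod_cast hm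
  have hm0 : (0 : ℝ) < ((m : ℤ) : ℝ) := by exact_mod_cast (by omega : (0 : ℤ) < m)
  choose F hF hF' using fun j : ℤ => slab (slabS m j) (slabP m j) (slabB m j) (gI V) (gS V)
  refine ⟨(Finset.Icc (-m : ℤ) m).image (fun j : ℤ => (j : ℝ) / ((m : ℤ) : ℝ)) ∪
    (Finset.Ico (-m : ℤ) m).biUnion F, ?_, ?_, ?_, ?_⟩
  · refine (Finset.card_union_le _ _).trans ?_
    have e1 := (Finset.card_image_le (s := Finset.Icc (-m : ℤ) m) (f := fun j : ℤ => (j : ℝ) / ((m : ℤ) : ℝ)))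
    have e2 : ((Finset.Ico (-m : ℤ) m).biUnion F).card ≤ (Finset.Ico (-m : ℤ) m).card * (12 * m + 1) := by
      apply Finset.card_biUnion_le_card_mul
      intro j _
      have := hF j
      have := slabS_card m j
      omega
    rw [Int.card_Icc] at e1
    rw [Int.card_Ico] at e2
    have e3 : ((m : ℤ) - (-m : ℤ)).toNat = 2 * m := by omega
    have e4 : ((m : ℤ) + 1 - (-m : ℤ)).toNat = 2 * m + 1 := by omega
    rw [e3] at e2
    rw [e4] at e1
    nlinarith
  · rw [Finset.mem_union, Finset.mem_image]
    exact Or.inl ⟨m, by simp, div_self hm0.ne'⟩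
  · rw [Finset.mem_union, Finset.mem_image]
    refine Or.inl ⟨-m, by simp, ?_⟩
    push_cast
    rw [neg_div]
    rw [div_self]
    exact_mod_cast hm0.ne'
  · intro s hs hs1 l k hf
    simp only [Finset.mem_union, Finset.mem_image, Finset.mem_biUnion, not_or, not_exists, not_and] at hs
    obtain ⟨hs2, hs3⟩ := hs
    rw [abs_lt] at hs1
    set j := ⌊((m : ℤ) : ℝ) * s⌋ with hj
    have j1 : (j : ℝ) ≤ ((m : ℤ) : ℝ) * s := Int.floor_le _
    have j2 : ((m : ℤ) : ℝ) * s < j + 1 := Int.lt_floor_add_one _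
    have j3 : -(m : ℤ) ≤ j := by
      rw [hj, Int.le_floor]
      push_cast at hm0 ⊢
      nlinarith
    have j4 : j < m := by
      rw [hj, Int.floor_lt]
      nlinarith
    have j1' : (j : ℝ) < ((m : ℤ) : ℝ) * s := by
      refine lt_of_le_of_ne j1 fun h => ?_
      apply hs2 j (by simp [j3, j4.le])
      rw [h]; field_simp
    have hev : ∀ᶠ x in 𝓝 s, (j : ℝ) < ((m : ℤ) : ℝ) * x ∧ ((m : ℤ) : ℝ) * x < j + 1 := by
      have hc : ContinuousAt (fun x : ℝ => ((m : ℤ) : ℝ) * x) s := by fun_prop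
      exact (hc.eventually (eventually_gt_nhds j1')).and (hc.eventually (eventually_lt_nhds j2))
    have := hF' j s (hs3 j (by simp [j3, j4])) (l, k)
      ((hf.and_eventually hev).mono fun x hx => (scon_iff hmz hx.2.1 hx.2.2 l k).1 hx.1)
    filter_upwards [this, hev] with x h1 h2
    exact (scon_iff hmz h2.1 h2.2 l k).2 h1

noncomputable def ux (t : ℝ) : ℝ := |t - 2| - 1
noncomputable def uy (t : ℝ) : ℝ := |t - 1| - |t - 3| + 2 - t

lemma ux_cont : Continuous ux := by unfold ux; fun_prop
lemma uy_cont : Continuous uy := by unfold uy; fun_prop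

lemma u_cases {t : ℝ} (h0 : 0 ≤ t) (h4 : t < 4) :
    (t ≤ 1 ∧ ux t = 1 - t ∧ uy t = - t) ∨ (1 ≤ t ∧ t ≤ 2 ∧ ux t = 1 - t ∧ uy t = t - 2) ∨
    (2 < t ∧ t ≤ 3 ∧ ux t = t - 3 ∧ uy t = t - 2) ∨ (3 ≤ t ∧ ux t = t - 3 ∧ uy t = 4 - t) := by
  unfold ux uy
  rcases le_total t 1 with h1 | h1
  · left
    rw [abs_of_nonpos (by linarith : t - 2 ≤ 0), abs_of_nonpos (by linarith : t - 1 ≤ 0),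
      abs_of_nonpos (by linarith : t - 3 ≤ 0)]
    exact ⟨h1, by ring, by ring⟩
  right
  rcases le_or_gt t 2 with h2 | h2
  · left
    rw [abs_of_nonpos (by linarith : t - 2 ≤ 0), abs_of_nonneg (by linarith : 0 ≤ t - 1),
      abs_of_nonpos (by linarith : t - 3 ≤ 0)]
    exact ⟨h1, h2, by ring, by ring⟩
  right
  rcases le_total t 3 with h3 | h3
  · left
    rw [abs_of_nonneg (by linarith : 0 ≤ t - 2), abs_of_nonneg (by linarith : 0 ≤ t - 1),
      abs_of_nonpos (by linarith : t - 3 ≤ 0)]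
    exact ⟨h2, h3, by ring, by ring⟩
  · right
    rw [abs_of_nonneg (by linarith : 0 ≤ t - 2), abs_of_nonneg (by linarith : 0 ≤ t - 1),
      abs_of_nonneg (by linarith : 0 ≤ t - 3)]
    exact ⟨h3, by ring, by ring⟩

lemma u_abs {t : ℝ} (h0 : 0 ≤ t) (h4 : t < 4) : |ux t| + |uy t| = 1 := by
  rcases u_cases h0 h4 with ⟨h1, hx, hy⟩ | ⟨h1, h2, hx, hy⟩ | ⟨h1, h2, hx, hy⟩ | ⟨h1, hx, hy⟩ <;>
    rw [hx, hy]
  · rw [abs_of_nonneg (by linarith), abs_of_nonpos (by linarith)]; ring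
  · rw [abs_of_nonpos (by linarith), abs_of_nonpos (by linarith)]; ring
  · rw [abs_of_nonpos (by linarith), abs_of_nonneg (by linarith)]; ring
  · rw [abs_of_nonneg (by linarith), abs_of_nonneg (by linarith)]; ring

lemma uy_sign {t : ℝ} (h0 : 0 ≤ t) (h4 : t < 4) : uy t ≤ 0 ↔ t ≤ 2 := by
  rcases u_cases h0 h4 with ⟨h1, hx, hy⟩ | ⟨h1, h2, hx, hy⟩ | ⟨h1, h2, hx, hy⟩ | ⟨h1, hx, hy⟩ <;>
    rw [hy] <;> constructor <;> intro <;> linarith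

lemma scale_abs {t : ℝ} (h0 : 0 ≤ t) (h4 : t < 4) {ρ : ℝ} (hρ : 0 < ρ) :
    |ρ * ux t| + |ρ * uy t| = ρ := by
  rw [abs_mul, abs_mul, abs_of_pos hρ, ← mul_add, u_abs h0 h4, mul_one]

lemma azimuth_u {t : ℝ} (h0 : 0 ≤ t) (h4 : t < 4) {ρ : ℝ} (hρ : 0 < ρ) (z : ℝ) :
    azimuth (ρ * ux t, ρ * uy t, z) = t := by
  unfold azimuth
  simp only [scale_abs h0 h4 hρ]
  rw [mul_div_cancel_left₀ _ hρ.ne']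
  have : ρ * uy t ≤ 0 ↔ t ≤ 2 := by
    rw [← uy_sign h0 h4]
    constructor
    · intro h; by_contra hn; push Not at hn; nlinarith
    · intro h; nlinarith
  simp only [this]
  unfold ux
  split_ifs with h
  · rw [abs_of_nonpos (by linarith)]; ring
  · rw [abs_of_pos (by linarith)]; ring

lemma azimuth_spec (x y z : ℝ) (h : 0 < |x| + |y|) :
    0 ≤ azimuth (x, y, z) ∧ azimuth (x, y, z) < 4 ∧
    x = (|x| + |y|) * ux (azimuth (x, y, z)) ∧ y = (|x| + |y|) * uy (azimuth (x, y, z)) := by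
  suffices hs : ∃ t ρ : ℝ, 0 ≤ t ∧ t < 4 ∧ 0 < ρ ∧ x = ρ * ux t ∧ y = ρ * uy t by
    obtain ⟨t, ρ, h0, h4, hρ, hx, hy⟩ := hs
    have e1 : azimuth (x, y, z) = t := by rw [hx, hy]; exact azimuth_u h0 h4 hρ z
    have e2 : |x| + |y| = ρ := by rw [hx, hy]; exact scale_abs h0 h4 hρ
    rw [e1, e2]
    exact ⟨h0, h4, hx, hy⟩
  set ρ := |x| + |y| with hρ
  have hxl : |x| ≤ ρ := by rw [hρ]; linarith [abs_nonneg y]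
  obtain ⟨hx1, hx2⟩ := abs_le.1 hxl
  have q1 : x / ρ ≤ 1 := by rw [div_le_one h]; exact hx2
  have q2 : -1 ≤ x / ρ := by rw [le_div_iff₀ h]; linarith
  have q3 : ρ * (x / ρ) = x := by field_simp
  by_cases hy : y ≤ 0
  · refine ⟨1 - x / ρ, ρ, by linarith, by linarith, h, ?_, ?_⟩
    · unfold ux
      rw [abs_of_nonpos (by linarith)]; linarith
    · unfold uy
      rw [abs_of_nonpos (by linarith : 1 - x / ρ - 3 ≤ 0)]
      have : ρ * |1 - x / ρ - 1| = |x| := by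
        rw [← abs_of_pos h, ← abs_mul, abs_of_pos h, ← abs_neg]
        congr 1
        linarith
      have hy' := abs_of_nonpos hy
      linarith
  · push Not at hy
    have hlt : x < ρ := by rw [hρ]; linarith [le_abs_self x, abs_pos.2 hy.ne']
    have q4 : x / ρ < 1 := by rw [div_lt_one h]; exact hlt
    refine ⟨3 + x / ρ, ρ, by linarith, by linarith, h, ?_, ?_⟩
    · unfold ux
      rw [abs_of_nonneg (by linarith)]; linarith
    · unfold uy
      rw [abs_of_nonneg (by linarith : 0 ≤ 3 + x / ρ - 1)]
      have : ρ * |3 + x / ρ - 3| = |x| := by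
        rw [← abs_of_pos h, ← abs_mul, abs_of_pos h]
        congr 1
        linarith
      have hy' := abs_of_pos hy
      linarith

def Side (a b : ℤ) : Prop := (a = 1 ∧ b = 0) ∨ (a = 0 ∧ b = -1) ∨ (a = -1 ∧ b = 0) ∨ (a = 0 ∧ b = 1)

def VV (Z : ℤ → ℤ → ℝ) (a b l k : ℤ) : ℝ := Z (k * a - l * b) (l * a + k * b)

def Seg (Z : ℤ → ℤ → ℝ) (a b l k : ℤ) : Set (ℝ × ℝ × ℝ) :=
  segment ℝ (gridPt Z (k * a - l * b) (l * a + k * b))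
    (gridPt Z ((k + 1) * a - l * b) (l * a + (k + 1) * b))

def EE (m : ℕ) : Set ((ℤ × ℤ) × (ℤ × ℤ)) := {e | ∃ k : ℕ, 1 ≤ k ∧ k ≤ m ∧ IsLayerEdge k e}

lemma max_facts {i j l : ℤ} (h : max |i| |j| = l) :
    (-l ≤ i ∧ i ≤ l) ∧ (-l ≤ j ∧ j ≤ l) ∧ (i = l ∨ i = -l ∨ j = l ∨ j = -l) := by
  simp only [abs_eq_max_neg] at h
  omega

lemma dist_facts {i j : ℤ} (h : |i| + |j| = 1) :
    (i = 0 ∧ j = 1) ∨ (i = 0 ∧ j = -1) ∨ (i = 1 ∧ j = 0) ∨ (i = -1 ∧ j = 0) := by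
  simp only [abs_eq_max_neg] at h
  omega

lemma edge_form {m : ℕ} (Z : ℤ → ℤ → ℝ) {e : (ℤ × ℤ) × (ℤ × ℤ)} (he : e ∈ EE m) :
    ∃ a b l k, Side a b ∧ 1 ≤ l ∧ l ≤ (m : ℤ) ∧ -l ≤ k ∧ k < l ∧ edgePts Z e = Seg Z a b l k := by
  obtain ⟨l, hl1, hlm, h1, h2, h3⟩ := he
  obtain ⟨⟨i1, j1⟩, ⟨i2, j2⟩⟩ := e
  simp only at h1 h2 h3
  replace h1 := max_facts h1
  replace h2 := max_facts h2
  replace h3 := dist_facts h3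
  obtain ⟨p1, p2, p3⟩ := h1
  obtain ⟨q1, q2, q3⟩ := h2
  have key : ∃ a b k, Side a b ∧ -(l : ℤ) ≤ k ∧ k < l ∧
      ((i1 = k * a - l * b ∧ j1 = l * a + k * b ∧ i2 = (k + 1) * a - l * b ∧ j2 = l * a + (k + 1) * b) ∨
       (i2 = k * a - l * b ∧ j2 = l * a + k * b ∧ i1 = (k + 1) * a - l * b ∧ j1 = l * a + (k + 1) * b)) := by
    rcases h3 with ⟨e1, e2⟩ | ⟨e1, e2⟩ | ⟨e1, e2⟩ | ⟨e1, e2⟩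
    · have hs : i1 = l ∨ i1 = -l := by omega
      rcases hs with hs | hs
      · exact ⟨0, -1, -j1, by simp [Side], by omega, by omega, by omega⟩
      · exact ⟨0, 1, j2, by simp [Side], by omega, by omega, by omega⟩
    · have hs : i1 = l ∨ i1 = -l := by omega
      rcases hs with hs | hs
      · exact ⟨0, -1, -j2, by simp [Side], by omega, by omega, by omega⟩
      · exact ⟨0, 1, j1, by simp [Side], by omega, by omega, by omega⟩
    · have hs : j1 = l ∨ j1 = -l := by omega
      rcases hs with hs | hs
      · exact ⟨1, 0, i2, by simp [Side], by omega, by omega, by omega⟩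
      · exact ⟨-1, 0, -i1, by simp [Side], by omega, by omega, by omega⟩
    · have hs : j1 = l ∨ j1 = -l := by omega
      rcases hs with hs | hs
      · exact ⟨1, 0, i1, by simp [Side], by omega, by omega, by omega⟩
      · exact ⟨-1, 0, -i2, by simp [Side], by omega, by omega, by omega⟩
  obtain ⟨a, b, k, hs, hk1, hk2, h⟩ := key
  refine ⟨a, b, l, k, hs, by omega, by omega, hk1, hk2, ?_⟩
  unfold edgePts Seg
  rcases h with ⟨rfl, rfl, rfl, rfl⟩ | ⟨rfl, rfl, rfl, rfl⟩
  · rfl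
  · exact segment_symm ℝ _ _

lemma form_edge {m : ℕ} (Z : ℤ → ℤ → ℝ) {a b l k : ℤ} (hs : Side a b) (h1 : 1 ≤ l) (h2 : l ≤ (m : ℤ))
    (h3 : -l ≤ k) (h4 : k < l) : ∃ e ∈ EE m, edgePts Z e = Seg Z a b l k := by
  refine ⟨((k * a - l * b, l * a + k * b), ((k + 1) * a - l * b, l * a + (k + 1) * b)), ?_, rfl⟩
  refine ⟨l.toNat, by omega, by omega, ?_⟩
  unfold IsLayerEdge
  rcases hs with ⟨rfl, rfl⟩ | ⟨rfl, rfl⟩ | ⟨rfl, rfl⟩ | ⟨rfl, rfl⟩ <;>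
    refine ⟨?_, ?_, ?_⟩ <;> simp only [abs_eq_max_neg] <;> omega

lemma mem_seg {Z : ℤ → ℤ → ℝ} {a b l k : ℤ} {r : ℝ × ℝ × ℝ} : r ∈ Seg Z a b l k ↔
    ∃ θ : ℝ, 0 ≤ θ ∧ θ ≤ 1 ∧ r = (l * a + (k + θ) * b, l * b - (k + θ) * a,
      (1 - θ) * VV Z a b l k + θ * VV Z a b l (k + 1)) := by
  unfold Seg
  rw [segment_eq_image]
  simp only [Set.mem_image, Set.mem_Icc]
  constructor
  · rintro ⟨θ, ⟨h0, h1⟩, rfl⟩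
    refine ⟨θ, h0, h1, ?_⟩
    simp only [gridPt, VV, Prod.smul_mk, Prod.mk_add_mk, smul_eq_mul, Prod.mk.injEq]
    push_cast
    refine ⟨by ring, by ring, trivial⟩
  · rintro ⟨θ, h0, h1, rfl⟩
    refine ⟨θ, ⟨h0, h1⟩, ?_⟩
    simp only [gridPt, VV, Prod.smul_mk, Prod.mk_add_mk, smul_eq_mul, Prod.mk.injEq]
    push_cast
    refine ⟨by ring, by ring, trivial⟩

noncomputable def NN (a b : ℤ) (t : ℝ) : ℝ := a * ux t + b * uy t
noncomputable def TT (a b : ℤ) (t : ℝ) : ℝ := b * ux t - a * uy t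

lemma side_unique {a b a' b' : ℤ} (h : Side a b) (h' : Side a' b') {x y : ℝ}
    (h1 : |(b : ℝ) * x - a * y| < a * x + b * y)
    (h2 : |(b' : ℝ) * x - a' * y| ≤ a' * x + b' * y) : a' = a ∧ b' = b := by
  rw [abs_lt] at h1
  rw [abs_le] at h2
  obtain ⟨h3, h4⟩ := h1
  obtain ⟨h5, h6⟩ := h2
  rcases h with ⟨rfl, rfl⟩ | ⟨rfl, rfl⟩ | ⟨rfl, rfl⟩ | ⟨rfl, rfl⟩ <;>
  rcases h' with ⟨rfl, rfl⟩ | ⟨rfl, rfl⟩ | ⟨rfl, rfl⟩ | ⟨rfl, rfl⟩ <;>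
  first
  | exact ⟨rfl, rfl⟩
  | (exfalso; push_cast at *; linarith)

lemma side_sq {a b : ℤ} (h : Side a b) : (a : ℝ) * a + b * b = 1 := by
  rcases h with ⟨rfl, rfl⟩ | ⟨rfl, rfl⟩ | ⟨rfl, rfl⟩ | ⟨rfl, rfl⟩ <;> norm_num

lemma val_form {m : ℕ} {Z : ℤ → ℤ → ℝ} {a b : ℤ} (hs : Side a b) {t : ℝ}
    (hT : |TT a b t| < NN a b t) {a' b' l k : ℤ} (hs' : Side a' b')
    (h1 : 1 ≤ l) (h2 : l ≤ (m : ℤ)) (h3 : -l ≤ k) (h4 : k < l) {r : ℝ × ℝ × ℝ}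
    (hr : r ∈ Seg Z a' b' l k) (hrt : azimuth r = t) :
    a' = a ∧ b' = b ∧ SAct m l k (TT a b t / NN a b t) ∧
    scrHeight r = NN a b t * (gI (VV Z a b) (l, k) + gS (VV Z a b) (l, k) * (TT a b t / NN a b t)) := by
  obtain ⟨θ, hθ0, hθ1, rfl⟩ := mem_seg.1 hr
  have sq := side_sq hs'
  have hN : 0 < NN a b t := lt_of_le_of_lt (abs_nonneg _) hT
  have hl0 : (1 : ℝ) ≤ l := by exact_mod_cast h1
  have hk3 : -(l : ℝ) ≤ k := by exact_mod_cast h3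
  have hk4 : (k : ℝ) + 1 ≤ l := by exact_mod_cast h4
  set x : ℝ := l * a' + (k + θ) * b' with hx
  set y : ℝ := l * b' - (k + θ) * a' with hy
  have en : a' * x + b' * y = l := by rw [hx, hy]; linear_combination (l : ℝ) * sq
  have et : b' * x - a' * y = k + θ := by rw [hx, hy]; linear_combination ((k : ℝ) + θ) * sq
  have hρ : 0 < |x| + |y| := by
    rcases eq_or_ne x 0 with h | h
    · rcases eq_or_ne y 0 with h' | h'
      · rw [h, h'] at en; linarith
      · have := abs_pos.2 h'; have := abs_nonneg x; linarith
    · have := abs_pos.2 h; have := abs_nonneg y; linarith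
  obtain ⟨-, -, ex, ey⟩ := azimuth_spec x y ((1 - θ) * VV Z a' b' l k + θ * VV Z a' b' l (k + 1)) hρ
  rw [hrt] at ex ey
  set ρ := |x| + |y| with hρd
  have hab : a' = a ∧ b' = b := by
    apply side_unique hs hs' (x := x) (y := y)
    · have e1 : (b : ℝ) * x - a * y = ρ * TT a b t := by
        unfold TT; rw [ex, ey]; ring
      have e2 : (a : ℝ) * x + b * y = ρ * NN a b t := by
        unfold NN; rw [ex, ey]; ring
      rw [e1, e2, abs_mul, abs_of_pos hρ]
      exact mul_lt_mul_of_pos_left hT hρ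
    · rw [en, et, abs_le]
      constructor <;> linarith
  obtain ⟨rfl, rfl⟩ := hab
  have e1 : (k : ℝ) + θ = ρ * TT a' b' t := by
    rw [← et]; unfold TT; linear_combination (b' : ℝ) * ex - a' * ey
  have e2 : (l : ℝ) = ρ * NN a' b' t := by
    rw [← en]; unfold NN; linear_combination (a' : ℝ) * ex + b' * ey
  have e3 : (l : ℝ) * (TT a' b' t / NN a' b' t) = k + θ := by
    rw [e1, e2]; field_simp
  refine ⟨rfl, rfl, ⟨h1, h2, h3, h4, by rw [e3]; linarith, by rw [e3]; linarith⟩, ?_⟩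
  unfold scrHeight gI gS
  simp only
  rw [← hρd]
  set s := TT a' b' t / NN a' b' t with hsd
  have hθ : θ = l * s - k := by linarith
  rw [hθ]
  have hl0' : (l : ℝ) ≠ 0 := by linarith
  have hρ' : ρ = l / NN a' b' t := by rw [e2]; field_simp
  rw [hρ']
  field_simp
  ring

lemma val_exists {m : ℕ} {Z : ℤ → ℤ → ℝ} {a b : ℤ} (hs : Side a b) {t : ℝ} (h0 : 0 ≤ t) (h4 : t < 4)
    (hT : |TT a b t| < NN a b t) {l k : ℤ} (hA : SAct m l k (TT a b t / NN a b t)) :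
    ∃ r ∈ Seg Z a b l k, azimuth r = t ∧ scrHeight r =
      NN a b t * (gI (VV Z a b) (l, k) + gS (VV Z a b) (l, k) * (TT a b t / NN a b t)) := by
  have hN : 0 < NN a b t := lt_of_le_of_lt (abs_nonneg _) hT
  obtain ⟨a1, a2, a3, a4, a5, a6⟩ := hA
  have sq := side_sq hs
  set s := TT a b t / NN a b t with hsd
  have hl0 : (1 : ℝ) ≤ l := by exact_mod_cast a1
  have hsN : s * NN a b t = TT a b t := by rw [hsd]; field_simp
  have hρ : 0 < l / NN a b t := by positivity
  have hρN : (l / NN a b t) * NN a b t = l := by field_simp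
  have hm : ((l * a + (k + (l * s - k)) * b, l * b - (k + (l * s - k)) * a,
      (1 - (l * s - k)) * VV Z a b l k + (l * s - k) * VV Z a b l (k + 1)) : ℝ × ℝ × ℝ) ∈ Seg Z a b l k :=
    mem_seg.2 ⟨l * s - k, by linarith, by linarith, rfl⟩
  refine ⟨_, hm, ?_⟩
  have haz : azimuth ((l * a + (k + (l * s - k)) * b, l * b - (k + (l * s - k)) * a,
      (1 - (l * s - k)) * VV Z a b l k + (l * s - k) * VV Z a b l (k + 1)) : ℝ × ℝ × ℝ) = t := by
    have ex : (l * a + (k + (l * s - k)) * b : ℝ) = (l / NN a b t) * ux t := by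
      have : ux t = NN a b t * a + TT a b t * b := by
        unfold NN TT; linear_combination -(ux t) * sq
      rw [this, ← hsN]
      linear_combination -(a + s * b : ℝ) * hρN
    have ey : (l * b - (k + (l * s - k)) * a : ℝ) = (l / NN a b t) * uy t := by
      have : uy t = NN a b t * b - TT a b t * a := by
        unfold NN TT; linear_combination -(uy t) * sq
      rw [this, ← hsN]
      linear_combination -(b - s * a : ℝ) * hρN
    rw [ex, ey]
    exact azimuth_u h0 h4 hρ _
  exact ⟨haz, (val_form hs hT hs a1 a2 a3 a4 hm haz).2.2.2⟩

def HC (Z : ℤ → ℤ → ℝ) (m : ℕ) (e : (ℤ × ℤ) × (ℤ × ℤ)) (t : ℝ) : Prop :=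
  ∃ r ∈ edgePts Z e, azimuth r = t ∧ scrHeight r = horizon Z (EE m) t

lemma hc_of_scon {m : ℕ} {Z : ℤ → ℤ → ℝ} {a b : ℤ} (hs : Side a b) {t : ℝ} (h0 : 0 ≤ t) (h4 : t < 4)
    (hT : |TT a b t| < NN a b t) {l k : ℤ} {e : (ℤ × ℤ) × (ℤ × ℤ)} (hee : e ∈ EE m)
    (he : edgePts Z e = Seg Z a b l k)
    (hc : SCon m (VV Z a b) l k (TT a b t / NN a b t)) : HC Z m e t := by
  have hN : 0 < NN a b t := lt_of_le_of_lt (abs_nonneg _) hT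
  obtain ⟨r, hr, hrt, hrh⟩ := val_exists (Z := Z) hs h0 h4 hT hc.1
  rw [← he] at hr
  refine ⟨r, hr, hrt, ?_⟩
  symm
  apply IsGreatest.csSup_eq
  refine ⟨⟨e, hee, r, hr, hrt, rfl⟩, ?_⟩
  rintro h ⟨e', he', r', hr', hrt', rfl⟩
  obtain ⟨a', b', l', k', hs', g1, g2, g3, g4, hE⟩ := edge_form Z he'
  rw [hE] at hr'
  obtain ⟨-, -, f1, f2⟩ := val_form hs hT hs' g1 g2 g3 g4 hr' hrt'
  rw [f2, hrh]
  exact mul_le_mul_of_nonneg_left (hc.2 _ _ f1) hN.le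

lemma scon_of_hc {m : ℕ} {Z : ℤ → ℤ → ℝ} {a b : ℤ} (hs : Side a b) {t : ℝ} (h0 : 0 ≤ t) (h4 : t < 4)
    (hT : |TT a b t| < NN a b t) {a' b' l k : ℤ} (hs' : Side a' b')
    (g1 : 1 ≤ l) (g2 : l ≤ (m : ℤ)) (g3 : -l ≤ k) (g4 : k < l) {e : (ℤ × ℤ) × (ℤ × ℤ)}
    (he : edgePts Z e = Seg Z a' b' l k) (hc : HC Z m e t) :
    a' = a ∧ b' = b ∧ SCon m (VV Z a b) l k (TT a b t / NN a b t) := by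
  have hN : 0 < NN a b t := lt_of_le_of_lt (abs_nonneg _) hT
  obtain ⟨r, hr, hrt, hrh⟩ := hc
  rw [he] at hr
  obtain ⟨e1, e2, f1, f2⟩ := val_form hs hT hs' g1 g2 g3 g4 hr hrt
  refine ⟨e1, e2, f1, ?_⟩
  intro l' k' hA
  obtain ⟨r', hr', hrt', hrh'⟩ := val_exists (Z := Z) hs h0 h4 hT hA
  obtain ⟨e', he', hE'⟩ := form_edge (m := m) Z hs hA.1 hA.2.1 hA.2.2.1 hA.2.2.2.1
  rw [← hE'] at hr'
  refine le_of_mul_le_mul_left ?_ hN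
  rw [← f2, ← hrh', hrh]
  apply le_csSup
  · apply Set.Finite.bddAbove
    apply Set.Finite.subset (((Finset.Icc (1 : ℤ) m ×ˢ Finset.Icc (-m : ℤ) m).image (fun x =>
      NN a b t * (gI (VV Z a b) x + gS (VV Z a b) x * (TT a b t / NN a b t)))).finite_toSet)
    rintro h ⟨e2, he2, r2, hr2, hrt2, rfl⟩
    obtain ⟨a', b', l', k', hs', g1, g2, g3, g4, hE⟩ := edge_form Z he2
    rw [hE] at hr2
    obtain ⟨-, -, f1, f2⟩ := val_form hs hT hs' g1 g2 g3 g4 hr2 hrt2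
    rw [f2]
    simp only [Finset.coe_image, Set.mem_image, Finset.mem_coe, Finset.mem_product, Finset.mem_Icc]
    exact ⟨(l', k'), ⟨⟨g1, g2⟩, by simp only; omega, by simp only; omega⟩, rfl⟩
  · exact ⟨e', he', r', hr', hrt', rfl⟩

lemma side_exists {t : ℝ} (h0 : 0 ≤ t) (h4 : t < 4) :
    ∃ a b, Side a b ∧ 0 < NN a b t ∧ |TT a b t| ≤ NN a b t := by
  have hu := u_abs h0 h4
  rcases le_total |uy t| |ux t| with h | h
  · rcases le_total 0 (ux t) with h' | h'
    · refine ⟨1, 0, by simp [Side], ?_, ?_⟩ <;> simp [NN, TT] <;> rw [abs_of_nonneg h'] at * <;> linarith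
    · refine ⟨-1, 0, by simp [Side], ?_, ?_⟩ <;> simp [NN, TT] <;> rw [abs_of_nonpos h'] at * <;> linarith
  · rcases le_total 0 (uy t) with h' | h'
    · refine ⟨0, 1, by simp [Side], ?_, ?_⟩ <;> simp [NN, TT] <;> rw [abs_of_nonneg h'] at * <;> linarith
    · refine ⟨0, -1, by simp [Side], ?_, ?_⟩ <;> simp [NN, TT] <;> rw [abs_of_nonpos h'] at * <;> linarith

lemma NN_cont (a b : ℤ) : Continuous (NN a b) := by
  have := ux_cont; have := uy_cont; unfold NN; fun_prop
lemma TT_cont (a b : ℤ) : Continuous (TT a b) := by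
  have := ux_cont; have := uy_cont; unfold TT; fun_prop

theorem stable (m : ℕ) (hm : 1 ≤ m) (Z : ℤ → ℤ → ℝ) : ∃ P : Finset ℝ,
    P.card ≤ 26 * (2 * m + 1) ^ 2 ∧ (0 : ℝ) ∈ P ∧ (4 : ℝ) ∈ P ∧
    ∀ t ∉ P, 0 ≤ t → t ≤ 4 → ∀ e ∈ EE m, (∃ᶠ x in 𝓝 t, HC Z m e x) → ∀ᶠ x in 𝓝 t, HC Z m e x := by
  classical
  choose Q hQc hQ1 hQ2 hQ using fun ab : ℤ × ℤ => side m hm (VV Z ab.1 ab.2)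
  set sides : Finset (ℤ × ℤ) := {(1, 0), (0, -1), (-1, 0), (0, 1)} with hsides
  have hcs : sides.card = 4 := by rw [hsides]; decide
  refine ⟨{0, 4} ∪ sides.biUnion (fun ab => (Q ab).image
    (fun s => azimuth ((ab.1 : ℝ) + s * ab.2, (ab.2 : ℝ) - s * ab.1, 0))), ?_, by simp, by simp, ?_⟩
  · refine (Finset.card_union_le _ _).trans ?_
    have e1 : (sides.biUnion (fun ab => (Q ab).image
        (fun s => azimuth ((ab.1 : ℝ) + s * ab.2, (ab.2 : ℝ) - s * ab.1, 0)))).card ≤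
        sides.card * (6 * (2 * m + 1) ^ 2) :=
      Finset.card_biUnion_le_card_mul _ _ _ fun ab _ => Finset.card_image_le.trans (hQc ab)
    have e2 : ({0, 4} : Finset ℝ).card ≤ 2 := Finset.card_le_two
    rw [hcs] at e1
    nlinarith
  · intro t ht h0 h4 e hee hf
    simp only [Finset.mem_union, Finset.mem_insert, Finset.mem_singleton, Finset.mem_biUnion,
      Finset.mem_image, not_or, not_exists, not_and] at ht
    obtain ⟨⟨ht0, ht4⟩, hts⟩ := ht
    have h0' : 0 < t := lt_of_le_of_ne h0 (Ne.symm ht0)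
    have h4' : t < 4 := lt_of_le_of_ne h4 ht4
    obtain ⟨a, b, hs, hN, hT⟩ := side_exists h0 h4'
    have sq := side_sq hs
    have hab : (a, b) ∈ sides := by
      rcases hs with ⟨rfl, rfl⟩ | ⟨rfl, rfl⟩ | ⟨rfl, rfl⟩ | ⟨rfl, rfl⟩ <;> simp [hsides]
    set s := TT a b t / NN a b t with hsd
    have hsN : s * NN a b t = TT a b t := by rw [hsd]; field_simp
    have hsQ : s ∉ Q (a, b) := by
      intro hsQ
      apply hts (a, b) hab s hsQ
      have hρ : 0 < 1 / NN a b t := by positivity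
      have hρN : (1 / NN a b t) * NN a b t = 1 := by field_simp
      have ex : (a + s * b : ℝ) = (1 / NN a b t) * ux t := by
        have : ux t = NN a b t * a + TT a b t * b := by
          unfold NN TT; linear_combination -(ux t) * sq
        rw [this, ← hsN]
        linear_combination -(a + s * b : ℝ) * hρN
      have ey : (b - s * a : ℝ) = (1 / NN a b t) * uy t := by
        have : uy t = NN a b t * b - TT a b t * a := by
          unfold NN TT; linear_combination -(uy t) * sq
        rw [this, ← hsN]
        linear_combination -(b - s * a : ℝ) * hρN
      simp only
      rw [ex, ey]
      exact azimuth_u h0 h4' hρ _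
    have hs1 : |s| < 1 := by
      have : |s| ≤ 1 := by
        rw [hsd, abs_div, abs_of_pos hN, div_le_one hN]; exact hT
      refine lt_of_le_of_ne this fun h => ?_
      rcases eq_or_eq_neg_of_abs_eq h with h | h
      · exact hsQ (h ▸ hQ1 _)
      · exact hsQ (h ▸ hQ2 _)
    have hT' : |TT a b t| < NN a b t := by
      rw [hsd, abs_div, abs_of_pos hN, div_lt_one hN] at hs1; exact hs1
    have hev : ∀ᶠ x in 𝓝 t, 0 ≤ x ∧ x < 4 ∧ |TT a b x| < NN a b x := by
      have c1 := (TT_cont a b).abs.continuousAt (x := t)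
      have c2 := (NN_cont a b).continuousAt (x := t)
      filter_upwards [eventually_gt_nhds h0', eventually_lt_nhds h4', c1.eventually_lt c2 hT'] with x h1 h2 h3
      exact ⟨h1.le, h2, h3⟩
    have hcont : Tendsto (fun x => TT a b x / NN a b x) (𝓝 t) (𝓝 s) :=
      ((TT_cont a b).continuousAt (x := t)).div ((NN_cont a b).continuousAt (x := t)) hN.ne'
    obtain ⟨a', b', l, k, hs', g1, g2, g3, g4, hE⟩ := edge_form Z hee
    have hf2 := (hf.and_eventually hev).mono fun x hx =>
      scon_of_hc hs hx.2.1 hx.2.2.1 hx.2.2.2 hs' g1 g2 g3 g4 hE hx.1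
    obtain ⟨-, rfl, rfl, -⟩ := hf2.exists
    have hf3 := hcont.frequently (hf2.mono fun x hx => hx.2.2)
    have := hcont.eventually (hQ (a', b') s hsQ hs1 l k hf3)
    filter_upwards [this, hev] with x hx1 hx2
    exact hc_of_scon hs hx2.1 hx2.2.1 hx2.2.2 hee hE hx1

lemma hc_range {m : ℕ} {Z : ℤ → ℤ → ℝ} {e : (ℤ × ℤ) × (ℤ × ℤ)} (he : e ∈ EE m) {t : ℝ}
    (h : HC Z m e t) : 0 ≤ t ∧ t < 4 := by
  obtain ⟨⟨x, y, z⟩, hr, hrt, -⟩ := h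
  obtain ⟨a, b, l, k, hs, g1, g2, g3, g4, hE⟩ := edge_form Z he
  rw [hE] at hr
  obtain ⟨θ, -, -, hr⟩ := mem_seg.1 hr
  simp only [Prod.mk.injEq] at hr
  obtain ⟨hx, hy, -⟩ := hr
  have sq := side_sq hs
  have hl0 : (1 : ℝ) ≤ l := by exact_mod_cast g1
  have en : a * x + b * y = l := by rw [hx, hy]; linear_combination (l : ℝ) * sq
  have hρ : 0 < |x| + |y| := by
    rcases eq_or_ne x 0 with h | h
    · rcases eq_or_ne y 0 with h' | h'
      · rw [h, h'] at en; linarith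
      · have := abs_pos.2 h'; have := abs_nonneg x; linarith
    · have := abs_pos.2 h; have := abs_nonneg y; linarith
  have := azimuth_spec x y z hρ
  rw [hrt] at this
  exact ⟨this.1, this.2.1⟩

lemma ordConn_union {I J : Set ℝ} (hI : I.OrdConnected) (hJ : J.OrdConnected) (h : (I ∩ J).Nonempty) :
    (I ∪ J).OrdConnected := by
  obtain ⟨x, h1, h2⟩ := h
  exact (hI.isPreconnected.union x h1 h2 hJ.isPreconnected).ordConnected

theorem inf_mem {m : ℕ} {Z : ℤ → ℤ → ℝ} {P : Finset ℝ} (hP0 : (0 : ℝ) ∈ P) (hP4 : (4 : ℝ) ∈ P)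
    (hP : ∀ t ∉ P, 0 ≤ t → t ≤ 4 → ∀ e ∈ EE m, (∃ᶠ x in 𝓝 t, HC Z m e x) → ∀ᶠ x in 𝓝 t, HC Z m e x)
    {I : Set ℝ} (hI : MaxHorizonPiece Z (EE m) I) : sInf I ∈ P ∧ BddBelow I := by
  obtain ⟨⟨hne, hoc, e, he, hIe⟩, hmax⟩ := hI
  have hr : ∀ t ∈ I, 0 ≤ t ∧ t < 4 := fun t ht => hc_range he (hIe t ht)
  have hbb : BddBelow I := ⟨0, fun t ht => (hr t ht).1⟩
  refine ⟨?_, hbb⟩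
  by_contra hn
  have hcl := csInf_mem_closure hne hbb
  have hfr := mem_closure_iff_frequently.1 hcl
  have hev := hP _ hn (le_csInf hne fun t ht => (hr t ht).1)
    (by obtain ⟨t, ht⟩ := hne; exact (csInf_le hbb ht).trans (hr t ht).2.le) e he
    (hfr.mono fun x hx => hIe x hx)
  rw [Metric.eventually_nhds_iff_ball] at hev
  obtain ⟨ε, hε, hball⟩ := hev
  rw [Real.ball_eq_Ioo] at hball
  obtain ⟨x, hx1, hx2⟩ := (hfr.and_eventually (Ioo_mem_nhds (by linarith : sInf I - ε < sInf I)
    (by linarith : sInf I < sInf I + ε))).exists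
  have hJ : HorizonPiece Z (EE m) (I ∪ Set.Ioo (sInf I - ε) (sInf I + ε)) := by
    refine ⟨hne.mono Set.subset_union_left, ordConn_union hoc Set.ordConnected_Ioo ⟨x, hx1, hx2⟩,
      e, he, ?_⟩
    rintro t (ht | ht)
    · exact hIe t ht
    · exact hball t ht
  have heq := hmax _ hJ Set.subset_union_left
  have : sInf I - ε / 2 ∈ I := by
    exact heq.subset (Or.inr ⟨by linarith, by linarith⟩)
  have := csInf_le hbb this
  linarith

lemma max_inj {m : ℕ} {Z : ℤ → ℤ → ℝ} {I J : Set ℝ} (hI : MaxHorizonPiece Z (EE m) I)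
    (hJ : MaxHorizonPiece Z (EE m) J) (bI : BddBelow I) (bJ : BddBelow J) (h1 : sInf I = sInf J)
    (h2 : sInf I ∈ I ↔ sInf J ∈ J) : I = J := by
  have key : I ⊆ J ∨ J ⊆ I := by
    by_contra hcon
    push Not at hcon
    obtain ⟨hc1, hc2⟩ := hcon
    obtain ⟨x, hxI, hxJ⟩ := Set.not_subset.1 hc1
    obtain ⟨y, hyJ, hyI⟩ := Set.not_subset.1 hc2
    have aux : ∀ (A B : Set ℝ) (u v : ℝ), A.OrdConnected → A.Nonempty → BddBelow A → BddBelow B →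
        sInf A = sInf B → (sInf A ∈ A ↔ sInf B ∈ B) → u ∈ A → v ∈ B → v ∉ A → v ≤ u → False := by
      intro A B u v hA hne bA bB e1 e2 hu hv hvA hvu
      rcases eq_or_lt_of_le (csInf_le bB hv) with h | h
      · apply hvA
        rw [← h, ← e1]
        exact e2.2 (h ▸ hv)
      · rw [← e1] at h
        obtain ⟨w, hw, hwv⟩ := exists_lt_of_csInf_lt hne h
        exact hvA (hA.out hw hu ⟨hwv.le, hvu⟩)
    rcases le_total y x with h | h
    · exact aux I J x y hI.1.2.1 hI.1.1 bI bJ h1 h2 hxI hyJ hyI h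
    · exact aux J I y x hJ.1.2.1 hJ.1.1 bJ bI h1.symm h2.symm hyJ hxI hxJ h
  rcases key with h | h
  · exact (hI.2 J hJ.1 h).symm
  · exact hJ.2 I hI.1 h

end HG

theorem horizon_of_grid_linear_complexity :
    ∃ C : ℕ, 0 < C ∧ ∀ m : ℕ, 1 ≤ m → ∀ Z : ℤ → ℤ → ℝ,
      {I : Set ℝ | MaxHorizonPiece Z
          {e | ∃ k : ℕ, 1 ≤ k ∧ k ≤ m ∧ IsLayerEdge k e} I}.Finite ∧
      {I : Set ℝ | MaxHorizonPiece Z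
          {e | ∃ k : ℕ, 1 ≤ k ∧ k ≤ m ∧ IsLayerEdge k e} I}.ncard
        ≤ C * (2 * m + 1) ^ 2 := by
  refine ⟨52, by norm_num, fun m hm Z => ?_⟩
  classical
  obtain ⟨P, hPc, hP0, hP4, hP⟩ := HG.stable m hm Z
  change {I : Set ℝ | MaxHorizonPiece Z (HG.EE m) I}.Finite ∧
    {I : Set ℝ | MaxHorizonPiece Z (HG.EE m) I}.ncard ≤ 52 * (2 * m + 1) ^ 2
  have hmaps : Set.MapsTo (fun I : Set ℝ => (sInf I, decide (sInf I ∈ I)))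
      {I : Set ℝ | MaxHorizonPiece Z (HG.EE m) I} ((P ×ˢ (Finset.univ : Finset Bool) : Finset (ℝ × Bool)) : Set (ℝ × Bool)) := by
    intro I hI
    simp only [Finset.coe_product, Set.mem_prod, Finset.mem_coe]
    exact ⟨(HG.inf_mem hP0 hP4 hP hI).1, Finset.mem_univ _⟩
  have hinj : Set.InjOn (fun I : Set ℝ => (sInf I, decide (sInf I ∈ I)))
      {I : Set ℝ | MaxHorizonPiece Z (HG.EE m) I} := by
    intro I hI J hJ h
    simp only [Prod.mk.injEq, decide_eq_decide] at h
    exact HG.max_inj hI hJ (HG.inf_mem hP0 hP4 hP hI).2 (HG.inf_mem hP0 hP4 hP hJ).2 h.1 h.2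
  refine ⟨Set.Finite.of_injOn hmaps hinj (Finset.finite_toSet _), ?_⟩
  refine (Set.ncard_le_ncard_of_injOn _ hmaps hinj (Finset.finite_toSet _)).trans ?_
  rw [Set.ncard_coe_finset, Finset.card_product]
  simp only [Finset.card_univ, Fintype.card_bool]
  omega
end
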